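/- Let F be a discretely valued Henselian field with perfect residue field, l a positive integer, and E/F a finite, at most l-ramified extension inside F^sep; let M/F be a finite Galois extension inside F^sep containing E. Then Gal(M/F)^l ⊆ Gal(M/E), and Gal(M/F)^l = Gal(M/E)^{ψ_{E/F}(l)}. Consequently, for any finitely ramified, at most l-ramified separable extension E/F embedded in F^sep, one has the equality of upper ramification subgroups I_F^l = I_E^{ψ_{E/F}(l)} inside Γ_E ⊆ Γ_F. -/

import Mathlib

noncomputable section

open scoped Classical

/-- An additive `ℝ ∪ {⊤}`-valued valuation on a field `Ω`. -/
structure AddVal (Ω : Type*) [Field Ω] where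
  v : Ω → WithTop ℝ
  v_zero : v 0 = ⊤
  v_ne_top : ∀ x : Ω, x ≠ 0 → v x ≠ ⊤
  v_mul : ∀ x y : Ω, v (x * y) = v x + v y
  v_min_le_add : ∀ x y : Ω, min (v x) (v y) ≤ v (x + y)

namespace AddVal

variable {Ω : Type*} [Field Ω]

/-- `V` is normalized on `F`: its value group on `F^×` is exactly `ℤ`.
This encodes that `F` is a discretely valued field and `V` extends the
normalized discrete valuation `val_F` of `F`. -/
def IsNormalizedOn (V : AddVal Ω) (F : Type*) [Field F] [Algebra F Ω] : Prop :=
  (∀ x : F, x ≠ 0 → ∃ k : ℤ, V.v (algebraMap F Ω x) = ((k : ℝ) : WithTop ℝ)) ∧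
    (∃ x : F, V.v (algebraMap F Ω x) = ((1 : ℝ) : WithTop ℝ))

/-- Henselian property of the valued field `(F, val_F)` (simple-root Hensel lemma). -/
def IsHenselianOn (V : AddVal Ω) (F : Type*) [Field F] [Algebra F Ω] : Prop :=
  ∀ f : Polynomial F,
    (∀ i : ℕ, 0 ≤ V.v (algebraMap F Ω (f.coeff i))) →
      ∀ a₀ : F, 0 ≤ V.v (algebraMap F Ω a₀) →
        0 < V.v (algebraMap F Ω (Polynomial.eval a₀ f)) →
        V.v (algebraMap F Ω (Polynomial.eval a₀ (Polynomial.derivative f))) = 0 →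
        ∃ a : F, Polynomial.eval a f = 0 ∧ 0 < V.v (algebraMap F Ω (a - a₀))

/-- The residue field of `(F, val_F)` is perfect: in positive residue characteristic `p`,
the Frobenius is surjective on the residue field. -/
def HasPerfectResidueFieldOn (V : AddVal Ω) (F : Type*) [Field F] [Algebra F Ω] : Prop :=
  ∀ p : ℕ, p.Prime → 0 < V.v (algebraMap F Ω (p : F)) →
    ∀ x : F, 0 ≤ V.v (algebraMap F Ω x) →
      ∃ y : F, 0 ≤ V.v (algebraMap F Ω y) ∧ 0 < V.v (algebraMap F Ω (x - y ^ p))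

/-- `e` is the (absolute) ramification index of `E` over the field on which `V` is
normalized: the value group of `E^×` is exactly `(1/e)ℤ`.  In particular `E` is
finitely ramified. -/
def IsRamIdx (V : AddVal Ω) {K : Type*} [Field K] [Algebra K Ω]
    (E : IntermediateField K Ω) (e : ℕ) : Prop :=
  0 < e ∧
    (∀ x : ↥E, x ≠ 0 → ∃ k : ℤ, V.v (x : Ω) = ((((k : ℝ) / (e : ℝ) : ℝ)) : WithTop ℝ)) ∧
    (∃ x : ↥E, V.v (x : Ω) = (((1 / (e : ℝ) : ℝ)) : WithTop ℝ))

end AddVal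

/-- The lower ramification relation `Ξ_r` on `K`-algebra embeddings of `E` into `Ω`,
where `e` is the absolute ramification index of `E` (over the normalization field of `V`):
`σ Ξ_r τ` iff `val_M (σ x - τ x) ≥ e(M/E) (r+1)` for all integral `x` and any (equivalently
some) suitable Galois `M`; this is equivalent to `V.v (σ x - τ x) ≥ (r+1)/e` for all
integral `x`. -/
def xiRel {Ω : Type*} [Field Ω] (V : AddVal Ω) {K : Type*} [Field K] [Algebra K Ω]
    (E : IntermediateField K Ω) (e : ℕ) (r : ℝ) (σ τ : ↥E →ₐ[K] Ω) : Prop :=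
  ∀ x : ↥E, 0 ≤ V.v (x : Ω) →
    ((((r + 1) / (e : ℝ) : ℝ)) : WithTop ℝ) ≤ V.v (σ x - τ x)

/-- `g_t`: the (common) cardinality of a `Ξ_t`-equivalence class, realized as the
cardinality of the class of the inclusion `E ↪ Ω`. -/
def gfun {Ω : Type*} [Field Ω] (V : AddVal Ω) {K : Type*} [Field K] [Algebra K Ω]
    (E : IntermediateField K Ω) (e : ℕ) (t : ℝ) : ℕ :=
  Nat.card {σ : ↥E →ₐ[K] Ω // xiRel V E e t σ E.val}

/-- The Herbrand function `φ_{E/K}(r) = ∫_0^r (g_t / g_0) dt`. -/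
def herbrand {Ω : Type*} [Field Ω] (V : AddVal Ω) {K : Type*} [Field K] [Algebra K Ω]
    (E : IntermediateField K Ω) (e : ℕ) (r : ℝ) : ℝ :=
  ∫ t in (0:ℝ)..r, ((gfun V E e t : ℝ) / (gfun V E e 0 : ℝ))

/-- `E/K` is at most `l`-ramified: for every finite subextension `E₀/K` the relation
`Ξ^l = Ξ_{ψ_{E₀/K}(l)}` is trivial. -/
def atMostRamified {Ω : Type*} [Field Ω] (V : AddVal Ω) {K : Type*} [Field K] [Algebra K Ω]
    (E : IntermediateField K Ω) (l : ℝ) : Prop :=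
  ∀ E₀ : IntermediateField K Ω, E₀ ≤ E → FiniteDimensional K ↥E₀ →
    ∀ (e₀ : ℕ) (s : ℝ), V.IsRamIdx E₀ e₀ → 0 ≤ s → herbrand V E₀ e₀ s = l →
      ∀ σ τ : ↥E₀ →ₐ[K] Ω, xiRel V E₀ e₀ s σ τ → σ = τ

/-- Membership of `γ ∈ Γ_K` in the upper ramification subgroup `I_K^l`: for every
finite Galois subextension `M/K` (with ramification index `eM` and `ψ_{M/K}(l) = sM`),
the image of `γ` in `Gal(M/K)` lies in `Gal(M/K)^l = Gal(M/K)_{ψ_{M/K}(l)}`. -/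
def inUpperRam {Ω : Type*} [Field Ω] (V : AddVal Ω) {K : Type*} [Field K] [Algebra K Ω]
    (l : ℝ) (γ : Ω ≃ₐ[K] Ω) : Prop :=
  ∀ (M : IntermediateField K Ω) (eM : ℕ) (sM : ℝ),
    FiniteDimensional K ↥M → IsGalois K ↥M → V.IsRamIdx M eM → 0 ≤ sM →
      herbrand V M eM sM = l →
      xiRel V M eM sM (γ.toAlgHom.comp M.val) M.val

section RamificationTheory

open Polynomial IsLocalRing

namespace AddVal

variable {Ω : Type*} [Field Ω] (V : AddVal Ω)

theorem v_one : V.v 1 = 0 := by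
  have h := V.v_mul 1 1
  have h1 := V.v_ne_top 1 one_ne_zero
  rw [mul_one] at h
  lift V.v 1 to ℝ using h1 with a
  norm_cast at h ⊢
  linarith

/-- The valuation `V` as a Mathlib `AddValuation`. -/
def toAddValuation : AddValuation Ω (WithTop ℝ) :=
  AddValuation.of V.v V.v_zero V.v_one V.v_min_le_add V.v_mul

theorem toAddValuation_apply (x : Ω) : V.toAddValuation x = V.v x := rfl

theorem v_eq_top_iff {x : Ω} : V.v x = ⊤ ↔ x = 0 :=
  ⟨fun h => by_contra fun hx => V.v_ne_top x hx h, fun h => h ▸ V.v_zero⟩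

theorem v_neg (x : Ω) : V.v (-x) = V.v x := V.toAddValuation.map_neg x

theorem v_sub_comm (x y : Ω) : V.v (x - y) = V.v (y - x) := V.toAddValuation.map_sub_swap x y

theorem min_le_v_sub (x y : Ω) : min (V.v x) (V.v y) ≤ V.v (x - y) := V.toAddValuation.map_sub x y

theorem v_pow (x : Ω) (n : ℕ) : V.v (x ^ n) = n • V.v x := V.toAddValuation.map_pow x n

theorem v_add_eq_of_lt {x y : Ω} (h : V.v x < V.v y) : V.v (x + y) = V.v x := by
  have := V.toAddValuation.map_add_eq_of_lt_left (x := x) (y := y) h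
  simpa [toAddValuation_apply] using this

theorem le_v_add {x y : Ω} {c : WithTop ℝ} (hx : c ≤ V.v x) (hy : c ≤ V.v y) : c ≤ V.v (x + y) :=
  (le_min hx hy).trans (V.v_min_le_add x y)

theorem le_v_sub {x y : Ω} {c : WithTop ℝ} (hx : c ≤ V.v x) (hy : c ≤ V.v y) : c ≤ V.v (x - y) :=
  (le_min hx hy).trans (V.min_le_v_sub x y)

theorem v_prod {ι : Type*} (s : Finset ι) (f : ι → Ω) :
    V.v (∏ i ∈ s, f i) = ∑ i ∈ s, V.v (f i) := by
  induction s using Finset.induction_on with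
  | empty => simpa using V.v_one
  | insert a s ha ih => rw [Finset.prod_insert ha, Finset.sum_insert ha, V.v_mul, ih]

theorem le_v_sum {ι : Type*} (s : Finset ι) (f : ι → Ω) {c : WithTop ℝ}
    (h : ∀ i ∈ s, c ≤ V.v (f i)) : c ≤ V.v (∑ i ∈ s, f i) :=
  V.toAddValuation.map_le_sum h

theorem v_inv {x : Ω} (hx : x ≠ 0) : V.v x⁻¹ + V.v x = 0 := by
  rw [← V.v_mul, inv_mul_cancel₀ hx, V.v_one]

/-- The valuation ring of `V` in `Ω`. -/
def ints : ValuationSubring Ω where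
  carrier := {x | 0 ≤ V.v x}
  mul_mem' {a b} ha hb := by
    simp only [Set.mem_ofPred_eq] at *
    rw [V.v_mul]
    exact add_nonneg ha hb
  one_mem' := by simp [V.v_one]
  add_mem' {a b} ha hb := V.le_v_add ha hb
  zero_mem' := by simp [V.v_zero]
  neg_mem' {a} ha := by simpa [V.v_neg] using ha
  mem_or_inv_mem' x := by
    by_cases hx : x = 0
    · simp [hx, V.v_zero]
    · have h := V.v_inv hx
      have h1 := V.v_ne_top x hx
      have h2 := V.v_ne_top _ (inv_ne_zero hx)
      simp only [Set.mem_ofPred_eq]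
      lift V.v x to ℝ using h1 with a
      lift V.v x⁻¹ to ℝ using h2 with b
      norm_cast at *
      rcases le_total 0 a with h0 | h0
      · exact Or.inl h0
      · right; linarith

theorem mem_ints {x : Ω} : x ∈ V.ints ↔ 0 ≤ V.v x := Iff.rfl

/-- The valuation ring of `V` in a field `K` over which `Ω` is an algebra. -/
def intsOf (K : Type*) [Field K] [Algebra K Ω] : ValuationSubring K :=
  V.ints.comap (algebraMap K Ω)

variable (K : Type*) [Field K] [Algebra K Ω]

theorem mem_intsOf {x : K} : x ∈ V.intsOf K ↔ 0 ≤ V.v (algebraMap K Ω x) := Iff.rfl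

instance : Algebra (V.intsOf K) V.ints :=
  RingHom.toAlgebra (((algebraMap K Ω).comp (V.intsOf K).subtype).codRestrict V.ints.toSubring
    fun x => x.2)

@[simp] theorem coe_algebraMap_intsOf (x : V.intsOf K) :
    ((algebraMap (V.intsOf K) V.ints x : V.ints) : Ω) = algebraMap K Ω (x : K) := rfl

theorem isUnit_ints_iff {x : V.ints} : IsUnit x ↔ V.v x = 0 := by
  constructor
  · rintro ⟨u, rfl⟩
    have h : V.v (u : V.ints) + V.v ((u⁻¹ : V.intsˣ) : V.ints) = 0 := by
      rw [← V.v_mul, ← V.v_one]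
      congr 1
      exact_mod_cast congrArg (Subtype.val) (u.mul_inv)
    have h1 : 0 ≤ V.v (u : V.ints) := (u : V.ints).2
    have h2 : 0 ≤ V.v ((u⁻¹ : V.intsˣ) : V.ints) := ((u⁻¹ : V.intsˣ) : V.ints).2
    refine le_antisymm ?_ h1
    rw [← h]
    exact le_add_of_nonneg_right h2
  · intro h
    have hx : (x : Ω) ≠ 0 := fun h0 => by simp [h0, V.v_zero] at h
    have h' := V.v_inv hx
    rw [h, add_zero] at h'
    refine IsUnit.of_mul_eq_one ⟨(x : Ω)⁻¹, h'.ge⟩ (Subtype.ext ?_)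
    exact mul_inv_cancel₀ hx

theorem isUnit_intsOf_iff {x : V.intsOf K} : IsUnit x ↔ V.v (algebraMap K Ω x) = 0 := by
  constructor
  · intro h
    simpa using V.isUnit_ints_iff.mp (h.map (algebraMap (V.intsOf K) V.ints))
  · intro h
    have hx : (x : K) ≠ 0 := fun h0 => by simp [h0, V.v_zero] at h
    have h' := V.v_inv (x := algebraMap K Ω x) (by simpa using hx)
    rw [h, add_zero] at h'
    refine IsUnit.of_mul_eq_one ⟨(x : K)⁻¹, ?_⟩ (Subtype.ext ?_)
    · rw [mem_intsOf, map_inv₀, h']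
    · exact mul_inv_cancel₀ hx

instance : IsLocalHom (algebraMap (V.intsOf K) V.ints) :=
  ⟨fun x hx => (V.isUnit_intsOf_iff K).mpr (by simpa using V.isUnit_ints_iff.mp hx)⟩

theorem residue_ints_eq_zero_iff {x : V.ints} : residue V.ints x = 0 ↔ 0 < V.v x := by
  rw [residue_eq_zero_iff, mem_maximalIdeal, mem_nonunits_iff, V.isUnit_ints_iff]
  exact ⟨fun h => lt_of_le_of_ne x.2 (Ne.symm h), fun h => h.ne'⟩

theorem residue_intsOf_eq_zero_iff {x : V.intsOf K} :
    residue (V.intsOf K) x = 0 ↔ 0 < V.v (algebraMap K Ω x) := by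
  rw [residue_eq_zero_iff, mem_maximalIdeal, mem_nonunits_iff, V.isUnit_intsOf_iff]
  exact ⟨fun h => lt_of_le_of_ne x.2 (Ne.symm h), fun h => h.ne'⟩

variable {K}

/-- Integral polynomials evaluated at residually equal points. -/
theorem residue_aeval (g : (V.intsOf K)[X]) (y : V.ints) :
    residue V.ints (aeval y g) =
      aeval (residue V.ints y) (g.map (residue (V.intsOf K))) := by
  rw [aeval_def, hom_eval₂, aeval_def, eval₂_map]
  rfl

theorem le_v_mul_of_right {x y : Ω} {c : WithTop ℝ} (hx : 0 ≤ V.v x) (hy : c ≤ V.v y) :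
    c ≤ V.v (x * y) := by
  rw [V.v_mul]
  exact hy.trans (le_add_of_nonneg_left hx)

theorem le_v_of_dvd {x y : V.ints} (h : x ∣ y) : V.v x ≤ V.v y := by
  obtain ⟨z, rfl⟩ := h
  rw [mul_comm]
  exact V.le_v_mul_of_right z.2 le_rfl

/-- The action of a field automorphism preserving `V` on the valuation ring. -/
def intsMap (σ : Ω →+* Ω) (h : ∀ x, V.v (σ x) = V.v x) : V.ints →+* V.ints :=
  (σ.comp V.ints.subtype).codRestrict V.ints.toSubring fun x => by
    change 0 ≤ V.v (σ x)
    rw [h]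
    exact x.2

@[simp] theorem coe_intsMap (σ : Ω →+* Ω) (h : ∀ x, V.v (σ x) = V.v x) (x : V.ints) :
    (V.intsMap σ h x : Ω) = σ x := rfl

end AddVal

theorem IntermediateField.exists_algEquiv_extending {K Ω : Type*} [Field K] [Field Ω] [Algebra K Ω]
    [Normal K Ω] (N : IntermediateField K Ω) (s : N →ₐ[K] Ω) :
    ∃ σ : Ω ≃ₐ[K] Ω, ∀ x : N, σ x = s x :=
  ⟨AlgEquiv.ofBijective (s.liftNormal Ω) (Algebra.IsAlgebraic.algHom_bijective _),
    fun x => s.liftNormal_commutes Ω x⟩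

namespace AddVal

variable {Ω : Type*} [Field Ω] (V : AddVal Ω)

/-- `V` is invariant under the automorphisms of `Ω` over `K`. -/
def IsInvariantOver (K : Type*) [Field K] [Algebra K Ω] : Prop :=
  ∀ (σ : Ω ≃ₐ[K] Ω) (x : Ω), V.v (σ x) = V.v x

/-- `y` generates the valuation ring of `N` as an algebra over the valuation ring of `K`. -/
def IsIntegralGenerator {K : Type*} [Field K] [Algebra K Ω] {N : IntermediateField K Ω}
    (y : V.intsOf N) : Prop :=
  ∀ z : V.intsOf N, ∃ g : (V.intsOf K)[X],
    aeval (algebraMap (V.intsOf N) V.ints y) g = algebraMap (V.intsOf N) V.ints z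

/-- Every integral element is residually separable over `K`: it is residually a simple root of an
integral polynomial over `K`. -/
def IsResiduallySeparableOver (K : Type*) [Field K] [Algebra K Ω] : Prop :=
  ∀ x : V.ints, ∃ g : (V.intsOf K)[X],
    residue V.ints (aeval x g) = 0 ∧ residue V.ints (aeval x (derivative g)) ≠ 0

/-- The properties of the base field on which the theory of lower numbering rests. -/
structure IsGoodBase (K : Type*) [Field K] [Algebra K Ω] : Prop where
  inv : V.IsInvariantOver K
  gen : ∀ N : IntermediateField K Ω, FiniteDimensional K N → ∃ y : V.intsOf N,
    V.IsIntegralGenerator y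
  sep : V.IsResiduallySeparableOver K

variable {V} {K : Type*} [Field K] [Algebra K Ω]

section Invariant

variable (hinv : V.IsInvariantOver K) {N : IntermediateField K Ω}

include hinv in
theorem IsInvariantOver.v_algHom [Normal K Ω] (s : N →ₐ[K] Ω) (x : N) :
    V.v (s x) = V.v (x : Ω) := by
  obtain ⟨σ, hσ⟩ := N.exists_algEquiv_extending s
  rw [← hσ, hinv]

/-- The ring homomorphism between valuation rings induced by an automorphism. -/
def IsInvariantOver.auto (σ : Ω ≃ₐ[K] Ω) : V.ints →+* V.ints :=
  V.intsMap (σ : Ω →+* Ω) (hinv σ)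

@[simp] theorem IsInvariantOver.coe_auto (σ : Ω ≃ₐ[K] Ω) (x : V.ints) :
    (hinv.auto σ x : Ω) = σ x := rfl

/-- The ring homomorphism between valuation rings induced by an embedding. -/
def IsInvariantOver.emb [Normal K Ω] (s : N →ₐ[K] Ω) : V.intsOf N →+* V.ints :=
  ((s : N →+* Ω).comp (V.intsOf N).subtype).codRestrict V.ints.toSubring fun x => by
    change 0 ≤ V.v (s x)
    rw [hinv.v_algHom]
    exact x.2

@[simp] theorem IsInvariantOver.coe_emb [Normal K Ω] (s : N →ₐ[K] Ω) (x : V.intsOf N) :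
    (hinv.emb s x : Ω) = s x := rfl

theorem IsInvariantOver.auto_aeval (σ : Ω ≃ₐ[K] Ω) (g : (V.intsOf K)[X]) (x : V.ints) :
    hinv.auto σ (aeval x g) = aeval (hinv.auto σ x) g := by
  rw [aeval_def, hom_eval₂, aeval_def]
  congr 1
  ext x
  simp

theorem IsInvariantOver.emb_eq_aeval [Normal K Ω] (s : N →ₐ[K] Ω) {y z : V.intsOf N}
    {g : (V.intsOf K)[X]}
    (h : aeval (algebraMap (V.intsOf N) V.ints y) g = algebraMap (V.intsOf N) V.ints z) :
    hinv.emb s z = aeval (hinv.emb s y) g := by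
  obtain ⟨σ, hσ⟩ := N.exists_algEquiv_extending s
  have h' := congrArg (hinv.auto σ) h
  rw [hinv.auto_aeval] at h'
  have key : ∀ w : V.intsOf N, hinv.auto σ (algebraMap (V.intsOf N) V.ints w) = hinv.emb s w :=
    fun w => Subtype.ext (hσ w)
  rw [key, key] at h'
  exact h'.symm

theorem IsInvariantOver.exists_map_eq [IsGalois K Ω] (P : V.ints[X])
    (hP : ∀ σ : Ω ≃ₐ[K] Ω, P.map (hinv.auto σ) = P) :
    ∃ Q : (V.intsOf K)[X], Q.map (algebraMap (V.intsOf K) V.ints) = P := by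
  rw [← mem_lifts, lifts_iff_coeff_lifts]
  intro i
  obtain ⟨k, hk⟩ := (InfiniteGalois.mem_range_algebraMap_iff_fixed (k := K)
    (P.coeff i : Ω)).mpr fun σ => by
      conv_rhs => rw [← hP σ]
      simp
  exact ⟨⟨k, by rw [mem_intsOf, hk]; exact (P.coeff i).2⟩, Subtype.ext hk⟩

end Invariant

theorem IsIntegralGenerator.algHom_ext [Normal K Ω] (hinv : V.IsInvariantOver K)
    {N : IntermediateField K Ω} {y : V.intsOf N}
    (hy : V.IsIntegralGenerator y) {s t : N →ₐ[K] Ω} (h : s y = t y) : s = t := by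
  have key : ∀ z : V.intsOf N, s z = t z := fun z => by
    obtain ⟨g, hg⟩ := hy z
    have h1 := hinv.emb_eq_aeval s hg
    have h2 := hinv.emb_eq_aeval t hg
    rw [show hinv.emb s y = hinv.emb t y from Subtype.ext h, ← h2] at h1
    exact congrArg Subtype.val h1
  ext z
  rcases (V.intsOf N).mem_or_inv_mem z with hz | hz
  · exact key ⟨z, hz⟩
  · have := key ⟨z⁻¹, hz⟩
    refine inv_injective ?_
    rw [← map_inv₀, ← map_inv₀]
    exact this

theorem IsIntegralGenerator.emb_injective [Normal K Ω] (hinv : V.IsInvariantOver K)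
    {N : IntermediateField K Ω} {y : V.intsOf N}
    (hy : V.IsIntegralGenerator y) : Function.Injective fun s : N →ₐ[K] Ω => hinv.emb s y :=
  fun _ _ h => hy.algHom_ext hinv (congrArg Subtype.val h)

theorem prod_X_sub_C_dvd {R ι : Type*} [CommRing R] [IsDomain R] (s : Finset ι) (f : ι → R)
    (hf : Set.InjOn f s) (p : R[X]) (h : ∀ i ∈ s, p.eval (f i) = 0) :
    ∏ i ∈ s, (X - C (f i)) ∣ p := by
  by_cases hp : p = 0
  · simp [hp]
  have := (Multiset.prod_X_sub_C_dvd_iff_le_roots hp (s.val.map f)).mpr ?_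
  · rwa [Multiset.map_map] at this
  · refine (Multiset.le_iff_subset ((Multiset.nodup_map_iff_inj_on s.nodup).mpr
      fun x hx y hy => hf hx hy)).mpr fun a ha => ?_
    obtain ⟨i, hi, rfl⟩ := Multiset.mem_map.mp ha
    exact (mem_roots hp).mpr (h i hi)

section Fiber

variable {L N : IntermediateField K Ω} (hLN : L ≤ N)

/-- Restriction of embeddings. -/
def restr (s : N →ₐ[K] Ω) : L →ₐ[K] Ω := s.comp (IntermediateField.inclusion hLN)

variable [FiniteDimensional K N]

/-- The embeddings of `N` extending a given embedding of `L`. -/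
def fiber (σ : L →ₐ[K] Ω) : Finset (N →ₐ[K] Ω) := Finset.univ.filter fun s => restr hLN s = σ

theorem mem_fiber {σ : L →ₐ[K] Ω} {s : N →ₐ[K] Ω} : s ∈ fiber hLN σ ↔ restr hLN s = σ := by
  simp [fiber]

theorem prod_fiber_comp {M : Type*} [CommMonoid M] (σ : L →ₐ[K] Ω) (τ : Ω ≃ₐ[K] Ω)
    (f : (N →ₐ[K] Ω) → M) :
    ∏ s ∈ fiber hLN σ, f ((τ : Ω →ₐ[K] Ω).comp s) =
      ∏ s ∈ fiber hLN ((τ : Ω →ₐ[K] Ω).comp σ), f s := by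
  refine Finset.prod_bij' (fun s _ => (τ : Ω →ₐ[K] Ω).comp s)
    (fun s _ => (τ.symm : Ω →ₐ[K] Ω).comp s) ?_ ?_ ?_ ?_ ?_
  · intro s hs
    rw [mem_fiber] at hs ⊢
    subst hs
    rfl
  · intro s hs
    rw [mem_fiber] at hs ⊢
    ext x
    have := congrArg (fun f => τ.symm (f x)) hs
    simpa [restr] using this
  · intro s _
    ext; simp
  · intro s _
    ext; simp
  · intro s _
    rfl

theorem sum_fiber_comp {M : Type*} [AddCommMonoid M] (σ : L →ₐ[K] Ω) (τ : Ω ≃ₐ[K] Ω)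
    (f : (N →ₐ[K] Ω) → M) :
    ∑ s ∈ fiber hLN σ, f ((τ : Ω →ₐ[K] Ω).comp s) =
      ∑ s ∈ fiber hLN ((τ : Ω →ₐ[K] Ω).comp σ), f s :=
  prod_fiber_comp (M := Multiplicative M) hLN σ τ f

variable [Normal K Ω] (hinv : V.IsInvariantOver K)

/-- The polynomial whose roots are the conjugates of `y` under the extensions of `σ`. -/
def fiberPoly (y : V.intsOf N) (σ : L →ₐ[K] Ω) : V.ints[X] :=
  ∏ s ∈ fiber hLN σ, (X - C (hinv.emb s y))

theorem map_fiberPoly (y : V.intsOf N) (σ : L →ₐ[K] Ω) (τ : Ω ≃ₐ[K] Ω) :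
    (fiberPoly hLN hinv y σ).map (hinv.auto τ) =
      fiberPoly hLN hinv y ((τ : Ω →ₐ[K] Ω).comp σ) := by
  rw [fiberPoly, Polynomial.map_prod, fiberPoly, ← prod_fiber_comp]
  refine Finset.prod_congr rfl fun s _ => ?_
  rw [Polynomial.map_sub, map_X, map_C]
  rfl

theorem coe_eval_fiberPoly (y : V.intsOf N) (σ : L →ₐ[K] Ω) (z : V.ints) :
    V.v (((fiberPoly hLN hinv y σ).eval z : V.ints) : Ω) =
      ∑ s ∈ fiber hLN σ, V.v (s y - z) := by
  rw [fiberPoly, eval_prod]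
  have : ((∏ s ∈ fiber hLN σ, eval z (X - C (hinv.emb s y)) : V.ints) : Ω) =
      ∏ s ∈ fiber hLN σ, ((z : Ω) - s y) := by
    have h := map_prod V.ints.subtype (fun s => eval z (X - C (hinv.emb s y))) (fiber hLN σ)
    refine h.trans (Finset.prod_congr rfl fun s _ => ?_)
    simp
  rw [this, V.v_prod]
  exact Finset.sum_congr rfl fun s _ => V.v_sub_comm _ _

theorem coeff_fiberPoly_mem [IsGalois K Ω] (y : V.intsOf N) (i : ℕ) :
    (((fiberPoly hLN hinv y L.val).coeff i : V.ints) : Ω) ∈ L := by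
  obtain ⟨k, hk⟩ := (InfiniteGalois.mem_range_algebraMap_iff_fixed (k := L)
    (((fiberPoly hLN hinv y L.val).coeff i : V.ints) : Ω)).mpr fun σ => by
      have h := map_fiberPoly hLN hinv y L.val (σ.restrictScalars K)
      have h' : (((σ.restrictScalars K : Ω ≃ₐ[K] Ω) : Ω →ₐ[K] Ω).comp L.val) = L.val := by
        ext x
        exact σ.commutes x
      rw [h'] at h
      conv_rhs => rw [← h]
      simp
  rw [← hk]
  exact k.2

include hinv in
/-- The sum formula for the lower numbering: the ramification depth of an embedding `σ` of `L` is
the sum of the depths of its extensions to `N`. -/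
theorem le_sum_fiber_iff [IsGalois K Ω] {y : V.intsOf N} (hy : V.IsIntegralGenerator y)
    (σ : L →ₐ[K] Ω) (c : WithTop ℝ) :
    (∀ x : L, 0 ≤ V.v (x : Ω) → c ≤ V.v (σ x - x)) ↔
      c ≤ ∑ s ∈ fiber hLN σ, V.v (s y - ((y : N) : Ω)) := by
  set y' : V.ints := algebraMap (V.intsOf N) V.ints y with hy'
  have hval := coe_eval_fiberPoly hLN hinv y σ y'
  change _ = ∑ s ∈ fiber hLN σ, V.v (s y - ((y : N) : Ω)) at hval
  rw [← hval]
  constructor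
  · intro h
    obtain ⟨τ, hτ⟩ := L.exists_algEquiv_extending σ
    have hσ : σ = (τ : Ω →ₐ[K] Ω).comp L.val := by
      ext x
      exact (hτ x).symm
    have h0 : (fiberPoly hLN hinv y L.val).eval y' = 0 := by
      rw [fiberPoly, eval_prod]
      refine Finset.prod_eq_zero (i := N.val) ((mem_fiber hLN).mpr rfl) ?_
      rw [eval_sub, eval_X, eval_C, sub_eq_zero]
      rfl
    have h1 : (fiberPoly hLN hinv y σ).eval y' =
        ((fiberPoly hLN hinv y σ) - (fiberPoly hLN hinv y L.val)).eval y' := by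
      rw [eval_sub, h0, sub_zero]
    rw [h1, eval_eq_sum, Polynomial.sum]
    have hs := map_sum V.ints.subtype (fun i =>
      ((fiberPoly hLN hinv y σ) - (fiberPoly hLN hinv y L.val)).coeff i * y' ^ i)
      ((fiberPoly hLN hinv y σ) - (fiberPoly hLN hinv y L.val)).support
    refine le_of_le_of_eq (V.le_v_sum _ _ fun i _ => ?_) (congrArg V.v hs.symm)
    rw [map_mul, mul_comm]
    refine V.le_v_mul_of_right (y' ^ i).2 ?_
    rw [hσ, ← map_fiberPoly, coeff_sub, coeff_map]
    have := h ⟨_, coeff_fiberPoly_mem hLN hinv y i⟩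
      ((fiberPoly hLN hinv y L.val).coeff i).2
    rw [← hτ] at this
    exact this
  · intro h x hx
    obtain ⟨g, hg⟩ := hy ⟨⟨x, hLN x.2⟩, hx⟩
    refine h.trans ?_
    set x' : V.ints := ⟨σ x, by rw [mem_ints, hinv.v_algHom]; exact hx⟩ with hx'
    have hdvd : fiberPoly hLN hinv y σ ∣ g.map (algebraMap (V.intsOf K) V.ints) - C x' := by
      refine prod_X_sub_C_dvd _ _ (hy.emb_injective hinv).injOn _ fun s hs => ?_
      rw [eval_sub, eval_map_algebraMap, eval_C, ← hinv.emb_eq_aeval s hg, sub_eq_zero]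
      refine Subtype.ext ?_
      rw [mem_fiber] at hs
      rw [hx', ← hs]
      rfl
    have h2 := V.le_v_of_dvd (eval_dvd hdvd (x := y'))
    rw [eval_sub, eval_map_algebraMap, hg, eval_C] at h2
    rw [V.v_sub_comm]
    exact h2

end Fiber

end AddVal

namespace AddVal

variable {Ω : Type*} [Field Ω] {V : AddVal Ω} {K : Type*} [Field K] [Algebra K Ω]

variable (V K) in
/-- The value group of `K` is `(1/e)ℤ`. -/
def FieldRamIdx (e : ℕ) : Prop :=
  0 < e ∧
    (∀ x : K, x ≠ 0 → ∃ k : ℤ, V.v (algebraMap K Ω x) = ((((k : ℝ) / (e : ℝ) : ℝ)) : WithTop ℝ)) ∧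
    (∃ x : K, V.v (algebraMap K Ω x) = (((1 / (e : ℝ) : ℝ)) : WithTop ℝ))

theorem isRamIdx_iff {N : IntermediateField K Ω} {e : ℕ} : V.IsRamIdx N e ↔ V.FieldRamIdx N e :=
  Iff.rfl

theorem FieldRamIdx.le_of_pos {e : ℕ} (h : V.FieldRamIdx K e) {x : K}
    (hx : 0 < V.v (algebraMap K Ω x)) :
    ((1 / (e : ℝ) : ℝ) : WithTop ℝ) ≤ V.v (algebraMap K Ω x) := by
  by_cases h0 : x = 0
  · simp [h0, V.v_zero]
  · obtain ⟨k, hk⟩ := h.2.1 x h0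
    have he : (0 : ℝ) < e := by exact_mod_cast h.1
    rw [hk] at hx ⊢
    have hx' : (0 : ℝ) < k / e := by exact_mod_cast hx
    have hk' : (0 : ℝ) < k := by
      by_contra! hc
      exact absurd hx' (not_lt.mpr (div_nonpos_of_nonpos_of_nonneg hc he.le))
    have h1 : (1 : ℝ) ≤ k := by exact_mod_cast (by exact_mod_cast hk' : (0 : ℤ) < k)
    have h2 : (1 / e : ℝ) ≤ k / e := by gcongr
    exact_mod_cast h2

theorem exists_intsOf_eq_aeval {N : IntermediateField K Ω} (y : V.intsOf N) (g : (V.intsOf K)[X]) :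
    ∃ z : V.intsOf N, algebraMap (V.intsOf N) V.ints z =
      aeval (algebraMap (V.intsOf N) V.ints y) g := by
  have h : algebraMap N Ω (g.eval₂ ((algebraMap K N).comp (V.intsOf K).subtype) (y : N)) =
      ((aeval (algebraMap (V.intsOf N) V.ints y) g : V.ints) : Ω) := by
    rw [hom_eval₂]
    change _ = V.ints.subtype _
    rw [aeval_def, hom_eval₂]
    rfl
  exact ⟨⟨_, by rw [mem_intsOf, h]; exact (aeval (algebraMap (V.intsOf N) V.ints y) g).2⟩,
    Subtype.ext h⟩

/-- An embedding that moves an integral element by a non-unit moves it by a multiple of a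
uniformizer. -/
theorem IsGoodBase.one_div_le [Normal K Ω] (hK : V.IsGoodBase K) {L : IntermediateField K Ω} {e : ℕ}
    (he : V.IsRamIdx L e) (σ : L →ₐ[K] Ω) {x : L} (hx : 0 ≤ V.v (x : Ω))
    (h : 0 < V.v (σ x - x)) : ((1 / (e : ℝ) : ℝ) : WithTop ℝ) ≤ V.v (σ x - x) := by
  set x' : V.intsOf L := ⟨x, hx⟩
  obtain ⟨g, hg0, hg1⟩ := hK.sep (algebraMap _ V.ints x')
  obtain ⟨z, hz⟩ := exists_intsOf_eq_aeval x' g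
  have hσz := hK.inv.emb_eq_aeval σ hz.symm
  rw [← hz, residue_ints_eq_zero_iff] at hg0
  have h1 : ((1 / (e : ℝ) : ℝ) : WithTop ℝ) ≤ V.v ((z : L) : Ω) :=
    (isRamIdx_iff.mp he).le_of_pos hg0
  have h2 : ((1 / (e : ℝ) : ℝ) : WithTop ℝ) ≤ V.v (σ z) := by rwa [hK.inv.v_algHom]
  set P := g.map (algebraMap (V.intsOf K) V.ints)
  set X' : V.ints := algebraMap _ V.ints x'
  set d : V.ints := hK.inv.emb σ x' - X' with hd
  obtain ⟨k, hk⟩ := P.binomExpansion X' d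
  have e1 : P.eval (X' + d) = hK.inv.emb σ z := by
    rw [hσz, eval_map_algebraMap, hd, add_sub_cancel]
  have e2 : P.eval X' = algebraMap _ V.ints z := by rw [hz, eval_map_algebraMap]
  have hres : residue V.ints d = 0 := (V.residue_ints_eq_zero_iff).mpr h
  have hunit : IsUnit (P.derivative.eval X' + k * d) := by
    rw [← residue_ne_zero_iff_isUnit, map_add, map_mul, hres, mul_zero, add_zero]
    rw [derivative_map, eval_map_algebraMap]
    exact hg1
  have hdvd : (hK.inv.emb σ z - algebraMap _ V.ints z) ∣ d := by
    rw [← e1, ← e2, hk, show P.eval X' + P.derivative.eval X' * d + k * d ^ 2 - P.eval X' =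
      d * (P.derivative.eval X' + k * d) by ring]
    obtain ⟨u, hu⟩ := hunit
    rw [← hu]
    exact Units.mul_right_dvd.mpr dvd_rfl
  exact (V.le_v_sub h2 h1).trans (V.le_v_of_dvd hdvd)

theorem FieldRamIdx.le_v_aeval {e : ℕ} (he : V.FieldRamIdx K e) {p : (V.intsOf K)[X]}
    (hp : p.map (residue (V.intsOf K)) = 0) (y : V.ints) :
    ((1 / (e : ℝ) : ℝ) : WithTop ℝ) ≤ V.v (aeval y p : V.ints) := by
  rw [aeval_eq_sum_range]
  have hs := map_sum V.ints.subtype (fun i => p.coeff i • y ^ i) (Finset.range (p.natDegree + 1))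
  refine le_of_le_of_eq (V.le_v_sum _ _ fun i _ => ?_) (congrArg V.v hs.symm)
  rw [Algebra.smul_def, map_mul, mul_comm]
  refine V.le_v_mul_of_right (y ^ i).2 ?_
  refine he.le_of_pos ((V.residue_intsOf_eq_zero_iff K).mp ?_)
  rw [← coeff_map, hp, coeff_zero]

theorem rootMultiplicity_prod_X_sub_C {R ι : Type*} [CommRing R] [IsDomain R] (s : Finset ι)
    (f : ι → R) (a : R) :
    rootMultiplicity a (∏ i ∈ s, (X - C (f i))) = (s.filter fun i => f i = a).card := by
  have h : ∏ i ∈ s, (X - C (f i)) = ((s.val.map f).map fun a => X - C a).prod := by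
    rw [Multiset.map_map]
    rfl
  rw [← count_roots, h, roots_multiset_prod_X_sub_C, Multiset.count_map]
  simp [Finset.card, eq_comm]

end AddVal

namespace AddVal

variable {Ω : Type*} [Field Ω] {V : AddVal Ω} {K : Type*} [Field K] [Algebra K Ω]

theorem map_map_residue (p : (V.intsOf K)[X]) :
    (p.map (residue (V.intsOf K))).map
        (algebraMap (ResidueField (V.intsOf K)) (ResidueField V.ints)) =
      (p.map (algebraMap (V.intsOf K) V.ints)).map (residue V.ints) := by
  rw [map_map, map_map]
  rfl

/-- An irreducible residual polynomial vanishing simply at the residue of `y`, together with a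
lift. -/
theorem IsResiduallySeparableOver.exists_minpoly (h : V.IsResiduallySeparableOver K) (y : V.ints) :
    IsIntegral (ResidueField (V.intsOf K)) (residue V.ints y) ∧
      rootMultiplicity (residue V.ints y)
        ((minpoly (ResidueField (V.intsOf K)) (residue V.ints y)).map
          (algebraMap _ (ResidueField V.ints))) = 1 := by
  obtain ⟨g, hg0, hg1⟩ := h y
  rw [residue_aeval] at hg0 hg1
  set G := g.map (residue (V.intsOf K)) with hG
  have hG0 : G ≠ 0 := by
    intro h0
    rw [← derivative_map, ← hG, h0] at hg1
    simp at hg1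
  have hint : IsIntegral (ResidueField (V.intsOf K)) (residue V.ints y) :=
    isAlgebraic_iff_isIntegral.mp ⟨G, hG0, hg0⟩
  refine ⟨hint, ?_⟩
  set H := minpoly (ResidueField (V.intsOf K)) (residue V.ints y) with hH
  have hH0 : H.map (algebraMap _ (ResidueField V.ints)) ≠ 0 :=
    (Polynomial.map_ne_zero_iff
      (algebraMap (ResidueField (V.intsOf K)) (ResidueField V.ints)).injective).mpr (minpoly.ne_zero hint)
  have hroot : (H.map (algebraMap _ (ResidueField V.ints))).IsRoot (residue V.ints y) := by
    rw [IsRoot, eval_map_algebraMap, hH, minpoly.aeval]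
  refine le_antisymm ?_ ((rootMultiplicity_pos hH0).mpr hroot)
  by_contra! hlt
  rw [one_lt_rootMultiplicity_iff_isRoot hH0] at hlt
  obtain ⟨q, hq⟩ := minpoly.dvd _ _ hg0
  refine hg1 ?_
  rw [← derivative_map, ← hG, hq, ← hH, derivative_mul, map_add, map_mul, map_mul]
  have h1 := hlt.2
  rw [IsRoot, derivative_map, eval_map_algebraMap] at h1
  rw [h1, zero_mul, hH, minpoly.aeval, zero_mul, zero_add]

/-- The number of residually trivial embeddings of `N` over `K` is the ramification index. -/
theorem IsGoodBase.card_inertia [IsGalois K Ω] (hK : V.IsGoodBase K) {N : IntermediateField K Ω}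
    [FiniteDimensional K N] {y : V.intsOf N} (hy : V.IsIntegralGenerator y) {eK eN : ℕ}
    (hKe : V.FieldRamIdx K eK) (hNe : V.IsRamIdx N eN) :
    (Finset.univ.filter fun s : N →ₐ[K] Ω => 0 < V.v (s y - (y : N))).card * eK = eN := by
  have hNe' := isRamIdx_iff.mp hNe
  set Y : V.ints := algebraMap (V.intsOf N) V.ints y with hY
  set m := (Finset.univ.filter fun s : N →ₐ[K] Ω => 0 < V.v (s y - (y : N))).card with hm
  set F : V.ints[X] := ∏ s : N →ₐ[K] Ω, (X - C (hK.inv.emb s y)) with hF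
  have hFfiber : F = fiberPoly (bot_le : (⊥ : IntermediateField K Ω) ≤ N) hK.inv y
      (⊥ : IntermediateField K Ω).val := by
    rw [fiberPoly, hF]
    congr 1
    ext s
    simp only [Finset.mem_univ, mem_fiber, true_iff]
    exact Subsingleton.elim _ _
  obtain ⟨F0, hF0⟩ := hK.inv.exists_map_eq F fun σ => by
    rw [hFfiber, map_fiberPoly]
    congr 1
    exact Subsingleton.elim _ _
  have hFY : aeval Y F0 = 0 := by
    rw [← eval_map_algebraMap, hF0, hF, eval_prod]
    refine Finset.prod_eq_zero (Finset.mem_univ N.val) ?_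
    rw [eval_sub, eval_X, eval_C, sub_eq_zero]
    rfl
  have hFmonic : (F.map (residue V.ints)).Monic :=
    (monic_prod_of_monic _ _ fun s _ => monic_X_sub_C _).map _
  have hFm : rootMultiplicity (residue V.ints Y) (F.map (residue V.ints)) = m := by
    have : F.map (residue V.ints) =
        ∏ s : N →ₐ[K] Ω, (X - C (residue V.ints (hK.inv.emb s y))) := by
      rw [hF, Polynomial.map_prod]
      simp
    rw [this, rootMultiplicity_prod_X_sub_C, hm]
    congr 1
    ext s
    simp only [Finset.mem_filter, Finset.mem_univ, true_and]
    rw [← sub_eq_zero, ← map_sub, residue_ints_eq_zero_iff]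
    rfl
  obtain ⟨hint, hmult⟩ := hK.sep.exists_minpoly Y
  set H := minpoly (ResidueField (V.intsOf K)) (residue V.ints Y) with hH
  have hHpow (a : ℕ) : rootMultiplicity (residue V.ints Y)
      ((H ^ a).map (algebraMap _ (ResidueField V.ints))) = a := by
    rw [Polynomial.map_pow, ← count_roots, roots_pow, Multiset.count_nsmul, count_roots, hmult,
      mul_one]
  have hmap : Function.Surjective (Polynomial.map (residue (V.intsOf K))) :=
    map_surjective _ residue_surjective
  obtain ⟨h, hh⟩ := hmap H
  obtain ⟨z, hz⟩ := exists_intsOf_eq_aeval y h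
  have hzpos : 0 < V.v (z : N) := by
    change 0 < V.v (algebraMap (V.intsOf N) V.ints z : V.ints)
    rw [← residue_ints_eq_zero_iff, hz, residue_aeval, hh, hH, minpoly.aeval]
  have hzge := hNe'.le_of_pos hzpos
  obtain ⟨π, hπ⟩ := hKe.2.2
  have heK : (0 : ℝ) < eK := by exact_mod_cast hKe.1
  have heN : (0 : ℝ) < eN := by exact_mod_cast hNe.1
  have hπ0 : π ≠ 0 := by
    rintro rfl
    rw [map_zero, V.v_zero] at hπ
    exact WithTop.top_ne_coe hπ
  obtain ⟨k, hk⟩ : ∃ k : ℕ, eN = k * eK := by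
    obtain ⟨j, hj⟩ := hNe'.2.1 (algebraMap K N π) (by simpa using hπ0)
    rw [← IsScalarTower.algebraMap_apply, hπ, WithTop.coe_inj] at hj
    have hj' : (eN : ℝ) = j * eK := by field_simp at hj; linarith
    have hj2 : (eN : ℤ) = j * eK := by exact_mod_cast hj'
    have hj0 : 0 ≤ j := by
      by_contra! hc
      nlinarith [hKe.1, hNe.1, (by exact_mod_cast hKe.1 : (0 : ℤ) < eK)]
    lift j to ℕ using hj0
    exact ⟨j, by exact_mod_cast hj2⟩
  have hk' : (eN : ℝ) = k * eK := by exact_mod_cast hk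
  have hk0 : 0 < k := by
    rcases Nat.eq_zero_or_pos k with h0 | h0
    · rw [h0, zero_mul] at hk
      exact absurd hk hNe.1.ne'
    · exact h0
  have hkdiv : (k : ℝ) * (1 / eN) = 1 / eK := by
    rw [hk']
    have : (k : ℝ) ≠ 0 := by exact_mod_cast hk0.ne'
    field_simp
  suffices m = k by rw [this, hk]
  refine le_antisymm ?_ ?_
  · have hzk : V.v (algebraMap K Ω π) ≤ V.v (((z : N) : Ω) ^ k) := by
      rw [V.v_pow, hπ, ← hkdiv]
      refine le_trans ?_ (nsmul_le_nsmul_right hzge k)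
      rw [← WithTop.coe_nsmul, nsmul_eq_mul]
    obtain ⟨w, hw⟩ : ∃ w : V.intsOf N, (z : N) ^ k = algebraMap K N π * w := by
      refine ⟨⟨(z : N) ^ k * (algebraMap K N π)⁻¹, ?_⟩, ?_⟩
      · rw [mem_intsOf, map_mul, V.v_mul, map_inv₀, map_pow, ← IsScalarTower.algebraMap_apply,
          ← V.v_inv (x := algebraMap K Ω π) (by simpa using hπ0), add_comm]
        gcongr
        exact hzk
      · have : algebraMap K N π ≠ 0 := by simpa using hπ0
        field_simp
    have hπi : π ∈ V.intsOf K := by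
      rw [mem_intsOf, hπ]
      exact_mod_cast (by positivity : (0 : ℝ) ≤ 1 / eK)
    obtain ⟨g, hg⟩ := hy w
    set Q : (V.intsOf K)[X] := h ^ k - C ⟨π, hπi⟩ * g with hQ
    have hQY : aeval Y Q = algebraMap (V.intsOf N) V.ints 0 := by
      rw [hQ, map_sub, map_pow, map_mul, aeval_C, ← hz, hg, map_zero, sub_eq_zero]
      refine Subtype.ext ?_
      exact congrArg (algebraMap N Ω) hw
    have hdvd : F ∣ Q.map (algebraMap (V.intsOf K) V.ints) := by
      refine prod_X_sub_C_dvd _ _ (hy.emb_injective hK.inv).injOn _ fun s _ => ?_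
      rw [eval_map_algebraMap, ← hK.inv.emb_eq_aeval s hQY, map_zero]
    have hdvd' := Polynomial.map_dvd (residue V.ints) hdvd
    have hQH : Q.map (residue (V.intsOf K)) = H ^ k := by
      have : residue (V.intsOf K) ⟨π, hπi⟩ = 0 := by
        rw [residue_intsOf_eq_zero_iff, hπ]
        exact_mod_cast (by positivity : (0 : ℝ) < 1 / eK)
      rw [hQ, Polynomial.map_sub, Polynomial.map_mul, map_C, this, C_0, zero_mul, sub_zero,
        Polynomial.map_pow, hh]
    rw [← map_map_residue, hQH] at hdvd'
    rw [← hFm, ← hHpow k]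
    refine rootMultiplicity_le_rootMultiplicity_of_dvd ?_ hdvd' _
    exact (Polynomial.map_ne_zero_iff
      (algebraMap (ResidueField (V.intsOf K)) (ResidueField V.ints)).injective).mpr
      (pow_ne_zero _ (minpoly.ne_zero hint))
  · rcases Nat.lt_or_ge 1 k with hk1 | hk1
    swap
    · refine hk1.trans (Finset.card_pos.mpr ⟨N.val, ?_⟩)
      simp [V.v_zero]
    have hlt : (1 / eN : ℝ) < 1 / eK := by
      rw [← hkdiv]
      have : (1 : ℝ) < k := by exact_mod_cast hk1
      nlinarith [one_div_pos.mpr heN]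
    set F1 := F0.map (residue (V.intsOf K)) with hF1
    have hF1map : F1.map (algebraMap _ (ResidueField V.ints)) = F.map (residue V.ints) := by
      rw [hF1, map_map_residue, hF0]
    have hF1ne : F1 ≠ 0 := by
      intro h0
      rw [h0, Polynomial.map_zero] at hF1map
      exact hFmonic.ne_zero hF1map.symm
    obtain ⟨a, q1, hq1, hFq⟩ := WfDvdMonoid.max_power_factor hF1ne (minpoly.irreducible hint)
    rw [← hH] at hFq hq1
    obtain ⟨q, rfl⟩ := hmap q1
    have ham : a ≤ m := by
      rw [← hFm, ← hHpow a, ← hF1map]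
      refine rootMultiplicity_le_rootMultiplicity_of_dvd
        ((Polynomial.map_ne_zero_iff
      (algebraMap (ResidueField (V.intsOf K)) (ResidueField V.ints)).injective).mpr hF1ne) ?_ _
      exact Polynomial.map_dvd _ (Dvd.intro _ hFq.symm)
    refine le_trans ?_ ham
    have hqY : V.v (aeval Y q : V.ints) = 0 := by
      rw [← isUnit_ints_iff, ← residue_ne_zero_iff_isUnit, residue_aeval]
      exact fun h0 => hq1 (minpoly.dvd _ _ h0)
    have h1 := hKe.le_v_aeval (p := h ^ a * q - F0) (by
      rw [Polynomial.map_sub, ← hF1, hFq, Polynomial.map_mul, Polynomial.map_pow, hh, sub_self]) Y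
    rw [map_sub, hFY, sub_zero, map_mul, map_pow, ← hz] at h1
    have h2 : ((1 / (eK : ℝ) : ℝ) : WithTop ℝ) ≤ a • V.v ((z : N) : Ω) := by
      refine h1.trans_eq ?_
      change V.v (((z : N) : Ω) ^ a * (aeval Y q : V.ints)) = _
      rw [V.v_mul, hqY, add_zero, V.v_pow]
    obtain ⟨ϖ, hϖ⟩ := hNe'.2.2
    obtain ⟨g, hg⟩ := hy ⟨ϖ, by
      rw [mem_intsOf, hϖ]
      exact_mod_cast (by positivity : (0 : ℝ) ≤ 1 / eN)⟩
    have hg0 : aeval (residue V.ints Y) (g.map (residue (V.intsOf K))) = 0 := by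
      rw [← residue_aeval, hg, residue_ints_eq_zero_iff]
      change 0 < V.v (algebraMap N Ω ϖ)
      rw [hϖ]
      exact_mod_cast (by positivity : (0 : ℝ) < 1 / eN)
    obtain ⟨q2, hq2⟩ := minpoly.dvd _ _ hg0
    obtain ⟨q3, rfl⟩ := hmap q2
    have h3 := hKe.le_v_aeval (p := h * q3 - g) (by
      rw [Polynomial.map_sub, hq2, Polynomial.map_mul, hh, sub_self]) Y
    have h4 : V.v ((z : N) : Ω) ≤ ((1 / (eN : ℝ) : ℝ) : WithTop ℝ) := by
      have h5 : V.v (aeval Y (h * q3) : V.ints) = ((1 / (eN : ℝ) : ℝ) : WithTop ℝ) := by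
        have h6 : ((aeval Y (h * q3) : V.ints) : Ω) =
            algebraMap N Ω ϖ + (aeval Y (h * q3 - g) : V.ints) := by
          rw [map_sub, hg]
          change _ = algebraMap N Ω ϖ + ((aeval Y (h * q3) : V.ints) - algebraMap N Ω ϖ : Ω)
          ring
        rw [h6, V.v_add_eq_of_lt, hϖ]
        rw [hϖ]
        exact lt_of_lt_of_le (by exact_mod_cast hlt) h3
      rw [← h5, map_mul, ← hz]
      exact V.le_v_of_dvd (Dvd.intro _ rfl)
    have h5 := h2.trans (nsmul_le_nsmul_right h4 a)
    rw [← WithTop.coe_nsmul, WithTop.coe_le_coe, nsmul_eq_mul, ← hkdiv] at h5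
    have h6 : (k : ℝ) ≤ a := le_of_mul_le_mul_right h5 (by positivity)
    exact_mod_cast h6

end AddVal

/-- The minimum of an extended real number and a real number, as a real number. -/
def cut (w : WithTop ℝ) (T : ℝ) : ℝ := min (w.untopD T) T

theorem coe_cut (w : WithTop ℝ) (T : ℝ) : (cut w T : WithTop ℝ) = min w T := by
  induction w with
  | top => simp [cut]
  | coe c => simp [cut]

theorem cut_top (T : ℝ) : cut ⊤ T = T := by simp [cut]

theorem cut_coe (c T : ℝ) : cut c T = min c T := by simp [cut]

theorem cut_mono (w : WithTop ℝ) : Monotone (cut w) := fun a b h => by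
  rw [← WithTop.coe_le_coe, coe_cut, coe_cut]
  exact min_le_min_left _ (WithTop.coe_le_coe.mpr h)

theorem continuous_cut (w : WithTop ℝ) : Continuous (cut w) := by
  induction w with
  | top => exact continuous_id.congr fun T => (cut_top T).symm
  | coe c => exact (continuous_const.min continuous_id).congr fun T => (cut_coe c T).symm

theorem cut_nonneg {w : WithTop ℝ} (hw : 0 ≤ w) {T : ℝ} (hT : 0 ≤ T) : 0 ≤ cut w T := by
  rw [← WithTop.coe_le_coe, coe_cut]
  exact le_min hw (WithTop.coe_le_coe.mpr hT)

theorem intervalIntegrable_threshold {e : ℝ} (he : 0 < e) (w : WithTop ℝ) (t : ℝ) :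
    IntervalIntegrable (fun u : ℝ => if (((u + 1) / e : ℝ) : WithTop ℝ) ≤ w then (1 : ℝ) else 0)
      MeasureTheory.volume 0 t := by
  refine Antitone.intervalIntegrable fun a b hab => ?_
  have : (((a + 1) / e : ℝ) : WithTop ℝ) ≤ ((b + 1) / e : ℝ) := by
    rw [WithTop.coe_le_coe]
    gcongr
  by_cases h : (((b + 1) / e : ℝ) : WithTop ℝ) ≤ w
  · simp [h, this.trans h]
  · simp only [h, if_false]
    split_ifs <;> norm_num

theorem integral_threshold {e : ℝ} (he : 0 < e) {w : WithTop ℝ} (hw0 : 0 ≤ w)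
    (hw : 0 < w → ((1 / e : ℝ) : WithTop ℝ) ≤ w) {t : ℝ} (ht : 0 ≤ t) :
    (∫ u in (0 : ℝ)..t, if (((u + 1) / e : ℝ) : WithTop ℝ) ≤ w then (1 : ℝ) else 0) +
      (if (((0 + 1) / e : ℝ) : WithTop ℝ) ≤ w then 1 else 0) = e * cut w ((t + 1) / e) := by
  induction w with
  | top =>
    simp only [le_top, if_true, cut_top, intervalIntegral.integral_const, smul_eq_mul]
    field_simp
    ring
  | coe c =>
    have hc0 : 0 ≤ c := by exact_mod_cast hw0
    simp only [WithTop.coe_le_coe, cut_coe]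
    rcases hc0.eq_or_lt with rfl | hc
    · have h1 : min 0 ((t + 1) / e) = 0 := min_eq_left (by positivity)
      have h2 : ¬ ((0 + 1) / e ≤ 0) := not_le.mpr (by positivity)
      rw [h1, if_neg h2, intervalIntegral.integral_congr (g := fun _ => 0)]
      · simp
      · intro u hu
        rw [Set.uIcc_of_le ht] at hu
        exact if_neg (not_le.mpr (by have := hu.1; positivity))
    · have h1 : 1 / e ≤ c := by exact_mod_cast hw (by exact_mod_cast hc)
      have h1' : 0 ≤ e * c - 1 := by
        rw [div_le_iff₀ he] at h1
        linarith
      rw [if_pos (by simpa using h1)]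
      have hle (u : ℝ) : (u + 1) / e ≤ c ↔ u ≤ e * c - 1 := by
        rw [div_le_iff₀ he, mul_comm, le_sub_iff_add_le]
      rcases le_total ((t + 1) / e) c with h2 | h2
      · rw [min_eq_right h2, intervalIntegral.integral_congr (g := fun _ => 1)]
        · simp
          field_simp
        · intro u hu
          rw [Set.uIcc_of_le ht] at hu
          refine if_pos ((hle u).mpr (hu.2.trans ((hle t).mp h2)))
      · rw [min_eq_left h2]
        have h3 : e * c - 1 ∈ Set.Icc 0 t := ⟨h1', by
          rw [le_div_iff₀ he] at h2
          linarith⟩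
        have h4 := intervalIntegral.integral_indicator (f := fun _ => (1 : ℝ))
          (μ := MeasureTheory.volume) h3
        simp only [intervalIntegral.integral_const, smul_eq_mul, sub_zero, mul_one,
          Set.indicator_apply, Set.mem_ofPred_eq] at h4
        simp only [hle]
        rw [h4]
        ring

namespace AddVal

variable {Ω : Type*} [Field Ω] {V : AddVal Ω} {K : Type*} [Field K] [Algebra K Ω] [IsGalois K Ω]

section

variable (hK : V.IsGoodBase K) {N : IntermediateField K Ω} [FiniteDimensional K N]
  {y : V.intsOf N} (hy : V.IsIntegralGenerator y) {e : ℕ}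

include hK hy

theorem IsGoodBase.forall_le_iff (s : N →ₐ[K] Ω) (c : WithTop ℝ) :
    (∀ x : N, 0 ≤ V.v (x : Ω) → c ≤ V.v (s x - x)) ↔ c ≤ V.v (s y - (y : N)) := by
  rw [le_sum_fiber_iff le_rfl hK.inv hy]
  have : fiber le_rfl s = {s} := by
    ext t
    rw [mem_fiber, Finset.mem_singleton]
    rfl
  rw [this, Finset.sum_singleton]

theorem IsGoodBase.xiRel_iff (t : ℝ) (s : N →ₐ[K] Ω) :
    xiRel V N e t s N.val ↔ (((t + 1) / (e : ℝ) : ℝ) : WithTop ℝ) ≤ V.v (s y - (y : N)) :=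
  hK.forall_le_iff hy s _

theorem IsGoodBase.gfun_eq (t : ℝ) : gfun V N e t = (Finset.univ.filter fun s : N →ₐ[K] Ω =>
    (((t + 1) / (e : ℝ) : ℝ) : WithTop ℝ) ≤ V.v (s y - (y : N))).card := by
  rw [gfun, ← Fintype.card_subtype, ← Nat.card_eq_fintype_card]
  exact Nat.card_congr (Equiv.subtypeEquivRight fun s => hK.xiRel_iff hy t s)

omit hy [FiniteDimensional K N] in
theorem IsGoodBase.v_sub_nonneg (y : V.intsOf N) (s : N →ₐ[K] Ω) :
    0 ≤ V.v (s y - (y : N)) :=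
  V.le_v_sub (by rw [hK.inv.v_algHom]; exact y.2) y.2

/-- The Herbrand function in terms of the depths of the embeddings. -/
theorem IsGoodBase.herbrand_eq {eK : ℕ} (hKe : V.FieldRamIdx K eK) (he : V.IsRamIdx N e) {t : ℝ}
    (ht : 0 ≤ t) : (herbrand V N e t + 1) / eK =
      ∑ s : N →ₐ[K] Ω, cut (V.v (s y - (y : N))) ((t + 1) / e) := by
  have he0 : (0 : ℝ) < e := by exact_mod_cast he.1
  have heK : (0 : ℝ) < eK := by exact_mod_cast hKe.1
  have h1 (s : N →ₐ[K] Ω) (hs : 0 < V.v (s y - (y : N))) :=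
    hK.one_div_le he s (x := (y : N)) y.2 hs
  have hg0 : gfun V N e 0 * eK = e := by
    rw [hK.gfun_eq hy]
    refine Eq.trans ?_ (hK.card_inertia hy hKe he)
    congr 2
    ext s
    simp only [Finset.mem_filter, Finset.mem_univ, true_and, zero_add]
    refine ⟨fun h => lt_of_lt_of_le ?_ h, h1 s⟩
    exact_mod_cast (by positivity : (0 : ℝ) < 1 / e)
  have hg0' : (gfun V N e 0 : ℝ) * eK = e := by exact_mod_cast hg0
  have hgpos : (0 : ℝ) < gfun V N e 0 := by
    by_contra! hc
    have := mul_nonpos_of_nonpos_of_nonneg hc heK.le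
    linarith
  have hsum (u : ℝ) : (gfun V N e u : ℝ) = ∑ s : N →ₐ[K] Ω,
      if (((u + 1) / (e : ℝ) : ℝ) : WithTop ℝ) ≤ V.v (s y - (y : N)) then (1 : ℝ) else 0 := by
    rw [hK.gfun_eq hy, Finset.card_filter]
    push_cast
    rfl
  have hint : herbrand V N e t * gfun V N e 0 + gfun V N e 0 =
      e * ∑ s : N →ₐ[K] Ω, cut (V.v (s y - (y : N))) ((t + 1) / e) := by
    rw [herbrand, intervalIntegral.integral_div, div_mul_cancel₀ _ hgpos.ne']
    simp_rw [hsum]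
    rw [intervalIntegral.integral_finsetSum fun s _ => intervalIntegrable_threshold he0 _ _,
      ← Finset.sum_add_distrib, Finset.mul_sum]
    exact Finset.sum_congr rfl fun s _ => integral_threshold he0 (hK.v_sub_nonneg y s) (h1 s) ht
  rw [div_eq_iff heK.ne']
  have h2 : (herbrand V N e t + 1) * gfun V N e 0 =
    ((∑ s : N →ₐ[K] Ω, cut (V.v (s y - (y : N))) ((t + 1) / e)) * eK) * gfun V N e 0 := by
    linear_combination hint - hg0' * ∑ s : N →ₐ[K] Ω, cut (V.v (s y - (y : N))) ((t + 1) / e)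
  exact mul_right_cancel₀ hgpos.ne' h2

end

theorem herbrand_zero {K : Type*} [Field K] [Algebra K Ω] (N : IntermediateField K Ω) (e : ℕ) :
    herbrand V N e 0 = 0 := intervalIntegral.integral_same

section

variable (hK : V.IsGoodBase K) {N : IntermediateField K Ω} [FiniteDimensional K N] {e eK : ℕ}
  (hKe : V.FieldRamIdx K eK) (he : V.IsRamIdx N e)

include hK hKe he

theorem IsGoodBase.herbrand_strictMonoOn : StrictMonoOn (herbrand V N e) (Set.Ici 0) := by
  intro a ha b hb hab
  obtain ⟨y, hy⟩ := hK.gen N ‹_›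
  have he0 : (0 : ℝ) < e := by exact_mod_cast he.1
  have heK : (0 : ℝ) < eK := by exact_mod_cast hKe.1
  have h1 := hK.herbrand_eq hy hKe he ha
  have h2 := hK.herbrand_eq hy hKe he hb
  have hT : (a + 1) / e < (b + 1) / e := by gcongr
  have : ∑ s : N →ₐ[K] Ω, cut (V.v (s y - (y : N))) ((a + 1) / e) <
      ∑ s : N →ₐ[K] Ω, cut (V.v (s y - (y : N))) ((b + 1) / e) := by
    refine Finset.sum_lt_sum (fun s _ => cut_mono _ hT.le) ⟨N.val, Finset.mem_univ _, ?_⟩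
    have : V.v (N.val y - (y : N)) = ⊤ := by simp [V.v_zero]
    rw [this, cut_top, cut_top]
    exact hT
  rw [← h1, ← h2, div_lt_div_iff_of_pos_right heK] at this
  linarith

theorem IsGoodBase.herbrand_nonneg {t : ℝ} (ht : 0 ≤ t) : 0 ≤ herbrand V N e t := by
  rw [← herbrand_zero (V := V) N e]
  exact (hK.herbrand_strictMonoOn hKe he).monotoneOn Set.self_mem_Ici ht ht

theorem IsGoodBase.herbrand_injOn {a b : ℝ} (ha : 0 ≤ a) (hb : 0 ≤ b)
    (h : herbrand V N e a = herbrand V N e b) : a = b :=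
  (hK.herbrand_strictMonoOn hKe he).injOn ha hb h

theorem IsGoodBase.exists_herbrand_eq {l : ℝ} (hl : 0 ≤ l) :
    ∃ t, 0 ≤ t ∧ herbrand V N e t = l := by
  obtain ⟨y, hy⟩ := hK.gen N ‹_›
  have he0 : (0 : ℝ) < e := by exact_mod_cast he.1
  have heK : (0 : ℝ) < eK := by exact_mod_cast hKe.1
  set R : ℝ → ℝ := fun t =>
    (∑ s : N →ₐ[K] Ω, cut (V.v (s y - (y : N))) ((t + 1) / e)) * eK - 1 with hR
  have hRe {t : ℝ} (ht : 0 ≤ t) : herbrand V N e t = R t := by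
    simp only [hR, ← hK.herbrand_eq hy hKe he ht]
    field_simp
    ring
  have hcont : Continuous R :=
    ((continuous_finsetSum _ fun s _ => (continuous_cut _).comp (by fun_prop)).mul
      continuous_const).sub continuous_const
  have hl' : 0 ≤ e * (l + 1) := by positivity
  have hle : l ≤ R (e * (l + 1)) := by
    have hT : 0 ≤ (e * (l + 1) + 1) / e := by positivity
    have h1 : (e * (l + 1) + 1) / e ≤
        ∑ s : N →ₐ[K] Ω, cut (V.v (s y - (y : N))) ((e * (l + 1) + 1) / e) := by
      refine le_trans (le_of_eq ?_) (Finset.single_le_sum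
        (fun s _ => cut_nonneg (hK.v_sub_nonneg y s) hT) (Finset.mem_univ N.val))
      have : V.v (N.val y - (y : N)) = ⊤ := by simp [V.v_zero]
      rw [this, cut_top]
    have h2 : l + 1 ≤ (e * (l + 1) + 1) / e := by
      rw [le_div_iff₀ he0]
      linarith
    have h3 : (1 : ℝ) ≤ eK := by exact_mod_cast hKe.1
    simp only [hR]
    nlinarith
  have h0 : R 0 = 0 := by rw [← hRe le_rfl, herbrand_zero]
  obtain ⟨t, ht, htl⟩ := intermediate_value_Icc hl' hcont.continuousOn ⟨h0.trans_le hl, hle⟩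
  exact ⟨t, ht.1, by rw [hRe ht.1, htl]⟩

end

end AddVal

namespace AddVal

variable {Ω : Type*} [Field Ω] {V : AddVal Ω} {K : Type*} [Field K] [Algebra K Ω]

section Transport

variable {L : IntermediateField K Ω}

variable (V L) in
/-- The inclusion of valuation rings. -/
def intsOfBaseChange : V.intsOf K →+* V.intsOf L :=
  ((algebraMap K L).comp (V.intsOf K).subtype).codRestrict (V.intsOf L).toSubring fun x => x.2

theorem aeval_map_intsOfBaseChange (y : V.ints) (g : (V.intsOf K)[X]) :
    aeval y (g.map (intsOfBaseChange V L)) = aeval y g := by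
  rw [aeval_def, eval₂_map]
  rfl

variable {N : IntermediateField K Ω} {N' : IntermediateField L Ω} (hN : ∀ x, x ∈ N' ↔ x ∈ N)

include hN in
theorem IsRamIdx.transport {e : ℕ} (h : V.IsRamIdx N e) : V.IsRamIdx N' e := by
  refine ⟨h.1, fun x hx => ?_, ?_⟩
  · exact h.2.1 ⟨x, (hN x).mp x.2⟩ fun h0 =>
      hx (Subtype.ext (show (x : Ω) = 0 from congrArg (Subtype.val : N → Ω) h0))
  · obtain ⟨x, hx⟩ := h.2.2
    exact ⟨⟨x, (hN x).mpr x.2⟩, hx⟩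

include hN in
theorem finiteDimensional_transport [FiniteDimensional K N] : FiniteDimensional L N' := by
  let φ : N →ₗ[K] N' :=
    { toFun := fun x => ⟨x, (hN x).mpr x.2⟩
      map_add' := fun _ _ => rfl
      map_smul' := fun c x => Subtype.ext (by
        simp only [Algebra.smul_def, RingHom.id_apply, MulMemClass.coe_mul]
        rfl) }
  have : FiniteDimensional K N' := Module.Finite.of_surjective φ fun x =>
    ⟨⟨x, (hN x).mp x.2⟩, rfl⟩
  exact FiniteDimensional.right K L N'

/-- The same element, over a bigger base. -/
def transportInts (y : V.intsOf N) : V.intsOf N' := ⟨⟨(y : N), (hN _).mpr (y : N).2⟩, y.2⟩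

theorem IsIntegralGenerator.transport {y : V.intsOf N} (hy : V.IsIntegralGenerator y) :
    V.IsIntegralGenerator (transportInts hN y) := by
  intro z
  obtain ⟨g, hg⟩ := hy ⟨⟨(z : N'), (hN _).mp (z : N').2⟩, z.2⟩
  refine ⟨g.map (intsOfBaseChange V L), ?_⟩
  rw [aeval_map_intsOfBaseChange]
  exact hg

/-- Embeddings over the bigger base as embeddings over the smaller base. -/
def lowerHom (s : N' →ₐ[L] Ω) : N →ₐ[K] Ω where
  toFun x := s ⟨x, (hN _).mpr x.2⟩
  map_one' := map_one s
  map_mul' x y := map_mul s ⟨x, (hN _).mpr x.2⟩ ⟨y, (hN _).mpr y.2⟩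
  map_zero' := map_zero s
  map_add' x y := map_add s ⟨x, (hN _).mpr x.2⟩ ⟨y, (hN _).mpr y.2⟩
  commutes' k := s.commutes (algebraMap K L k)

/-- Embeddings over the smaller base which are trivial on `L` as embeddings over `L`. -/
def upperHom (hLN : L ≤ N) (s : N →ₐ[K] Ω) (hs : restr hLN s = L.val) : N' →ₐ[L] Ω where
  toFun x := s ⟨x, (hN _).mp x.2⟩
  map_one' := map_one s
  map_mul' x y := map_mul s ⟨x, (hN _).mp x.2⟩ ⟨y, (hN _).mp y.2⟩
  map_zero' := map_zero s
  map_add' x y := map_add s ⟨x, (hN _).mp x.2⟩ ⟨y, (hN _).mp y.2⟩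
  commutes' k := congrArg (fun f : L →ₐ[K] Ω => f k) hs

theorem restr_lowerHom (hLN : L ≤ N) (s : N' →ₐ[L] Ω) : restr hLN (lowerHom hN s) = L.val := by
  ext x
  exact s.commutes x

theorem sum_fiber_val [FiniteDimensional K N] [Fintype (N' →ₐ[L] Ω)]
    {A : Type*} [AddCommMonoid A] (hLN : L ≤ N) (f : Ω → A)
    (y : V.intsOf N) :
    ∑ s ∈ fiber hLN L.val, f (s y) =
      ∑ s : N' →ₐ[L] Ω, f (s ((transportInts hN y : V.intsOf N') : N')) := by
  symm
  refine Finset.sum_bij (fun s _ => lowerHom hN s) ?_ ?_ ?_ ?_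
  · intro s _
    exact (mem_fiber hLN).mpr (restr_lowerHom hN hLN s)
  · intro s _ t _ h
    ext x
    exact congrArg (fun f : N →ₐ[K] Ω => f ⟨x, (hN _).mp x.2⟩) h
  · intro s hs
    exact ⟨upperHom hN hLN s ((mem_fiber hLN).mp hs), Finset.mem_univ _, rfl⟩
  · intro s _
    rfl

end Transport

section Tower

variable [IsGalois K Ω] (hK : V.IsGoodBase K) {L N : IntermediateField K Ω} (hLN : L ≤ N)
  [FiniteDimensional K N]

include hK in
theorem IsGoodBase.exists_fiber_depth (y : V.intsOf N) (σ : L →ₐ[K] Ω) :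
    ∃ j : WithTop ℝ, (∀ s ∈ fiber hLN σ, V.v (s y - (y : N)) ≤ j) ∧
      ∀ c, ∑ s ∈ fiber hLN σ, min (V.v (s y - (y : N))) c =
        ∑ h ∈ fiber hLN L.val, min (V.v (h y - (y : N))) (min j c) := by
  have hne : (fiber hLN σ).Nonempty := by
    obtain ⟨τ, hτ⟩ := L.exists_algEquiv_extending σ
    refine ⟨(τ : Ω →ₐ[K] Ω).comp N.val, (mem_fiber hLN).mpr ?_⟩
    ext x
    exact hτ x
  obtain ⟨s0, hs0, hmax⟩ := Finset.exists_max_image _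
    (fun s : N →ₐ[K] Ω => V.v (s y - (y : N))) hne
  refine ⟨V.v (s0 y - (y : N)), hmax, fun c => ?_⟩
  obtain ⟨τ, hτ⟩ := N.exists_algEquiv_extending s0
  have hσ : (τ : Ω →ₐ[K] Ω).comp L.val = σ := by
    rw [← (mem_fiber hLN).mp hs0]
    ext x
    exact hτ ⟨x, hLN x.2⟩
  rw [← hσ, ← sum_fiber_comp]
  refine Finset.sum_congr rfl fun h hh => ?_
  rw [← min_assoc]
  congr 1
  have hmem : (τ : Ω →ₐ[K] Ω).comp h ∈ fiber hLN σ := by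
    rw [mem_fiber] at hh ⊢
    rw [← hσ, ← hh]
    rfl
  have h1 := hmax _ hmem
  have h2 : ((τ : Ω →ₐ[K] Ω).comp h) y - (y : N) =
      (τ (h y - (y : N))) + (s0 y - (y : N)) := by
    rw [map_sub, hτ]
    simp
  rcases lt_or_ge (V.v (h y - (y : N))) (V.v (s0 y - (y : N))) with hlt | hge
  · rw [min_eq_left hlt.le, h2, V.v_add_eq_of_lt (by rwa [hK.inv]), hK.inv]
  · rw [min_eq_right hge]
    refine le_antisymm h1 ?_
    rw [h2]
    exact V.le_v_add (by rwa [hK.inv]) le_rfl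

variable (hL : V.IsGoodBase L) {N' : IntermediateField L Ω} (hN : ∀ x, x ∈ N' ↔ x ∈ N)
  {eK eL eN : ℕ} (hKe : V.FieldRamIdx K eK) (hLe : V.IsRamIdx L eL) (hNe : V.IsRamIdx N eN)
  {t : ℝ} (ht : 0 ≤ t)

include hK hKe ht in
theorem IsGoodBase.coe_herbrand_eq {e : ℕ} (he : V.IsRamIdx N e)
    {y : V.intsOf N} (hy : V.IsIntegralGenerator y) :
    (((herbrand V N e t + 1) / eK : ℝ) : WithTop ℝ) =
      ∑ s : N →ₐ[K] Ω, min (V.v (s y - (y : N))) ((t + 1) / e : ℝ) := by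
  rw [hK.herbrand_eq hy hKe he ht, WithTop.coe_sum]
  exact Finset.sum_congr rfl fun s _ => coe_cut _ _

include hL hN hLe hNe ht in
theorem IsGoodBase.coe_herbrand_eq_sum_fiber {y : V.intsOf N} (hy : V.IsIntegralGenerator y) :
    (((herbrand V N' eN t + 1) / eL : ℝ) : WithTop ℝ) =
      ∑ s ∈ fiber hLN L.val, min (V.v (s y - (y : N))) ((t + 1) / eN : ℝ) := by
  have : FiniteDimensional L N' := finiteDimensional_transport hN
  rw [hL.coe_herbrand_eq hLe ht (hNe.transport hN) (hy.transport hN),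
    sum_fiber_val hN hLN (fun x => min (V.v (x - (y : N))) ((t + 1) / eN : ℝ)) y]
  rfl

include hK in
theorem IsGoodBase.v_sub_eq_sum_fiber {y : V.intsOf N} (hy : V.IsIntegralGenerator y)
    [FiniteDimensional K L] {z : V.intsOf L} (hz : V.IsIntegralGenerator z) (σ : L →ₐ[K] Ω) :
    V.v (σ z - (z : L)) = ∑ s ∈ fiber hLN σ, V.v (s y - (y : N)) :=
  eq_of_forall_le_iff fun c => by
    rw [← hK.forall_le_iff hz, le_sum_fiber_iff hLN hK.inv hy]

include hK hLN hL hN hLe hNe ht in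
/-- Restriction of embeddings is compatible with the lower numbering, reindexed by the Herbrand
function of the top layer. -/
theorem IsGoodBase.xiRel_restr {s : N →ₐ[K] Ω} (hs : xiRel V N eN t s N.val) :
    xiRel V L eL (herbrand V N' eN t) (restr hLN s) L.val := by
  obtain ⟨y, hy⟩ := hK.gen N ‹_›
  obtain ⟨j, hj, hsum⟩ := hK.exists_fiber_depth hLN y (restr hLN s)
  refine (le_sum_fiber_iff hLN hK.inv hy _ _).mpr ?_
  rw [hK.xiRel_iff hy] at hs
  have hj' := hs.trans (hj s ((mem_fiber hLN).mpr rfl))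
  have h := hsum ⊤
  simp only [le_top, inf_of_le_left] at h
  rw [h, hL.coe_herbrand_eq_sum_fiber hLN hN hLe hNe ht hy]
  exact Finset.sum_le_sum fun s _ => min_le_min_left _ hj'

include hK hLN hL hN hKe hLe hNe ht in
/-- The Herbrand functions compose in towers. -/
theorem IsGoodBase.herbrand_tower :
    herbrand V N eN t = herbrand V L eL (herbrand V N' eN t) := by
  have : FiniteDimensional K L :=
    FiniteDimensional.of_injective (IntermediateField.inclusion hLN).toLinearMap
      (IntermediateField.inclusion_injective hLN)
  have : FiniteDimensional L N' := finiteDimensional_transport hN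
  obtain ⟨y, hy⟩ := hK.gen N ‹_›
  obtain ⟨z, hz⟩ := hK.gen L ‹_›
  have heK : (0 : ℝ) < eK := by exact_mod_cast hKe.1
  have hr : 0 ≤ herbrand V N' eN t :=
    hL.herbrand_nonneg (eK := eL) hLe (hNe.transport hN) ht
  have key : (((herbrand V N eN t + 1) / eK : ℝ) : WithTop ℝ) =
      (((herbrand V L eL (herbrand V N' eN t) + 1) / eK : ℝ) : WithTop ℝ) := by
    rw [hK.coe_herbrand_eq hKe ht hNe hy, hK.coe_herbrand_eq hKe hr hLe hz,
      hL.coe_herbrand_eq_sum_fiber hLN hN hLe hNe ht hy,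
      ← Finset.sum_fiberwise Finset.univ (restr hLN)]
    refine Finset.sum_congr rfl fun σ _ => ?_
    obtain ⟨j, hj, hsum⟩ := hK.exists_fiber_depth hLN y σ
    rw [hK.v_sub_eq_sum_fiber hLN hy hz]
    have h := hsum ⊤
    simp only [le_top, inf_of_le_left] at h
    rw [h]
    refine (hsum _).trans ?_
    have hmono : Monotone fun c : WithTop ℝ =>
        ∑ h ∈ fiber hLN L.val, min (V.v (h y - (y : N))) c := fun a b hab =>
      Finset.sum_le_sum fun s _ => min_le_min_left _ hab
    exact hmono.map_min
  rw [WithTop.coe_inj, div_left_inj' heK.ne'] at key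
  linarith

end Tower

end AddVal

namespace AddVal

variable {Ω : Type*} [Field Ω]

theorem IsGoodBase.intermediateField {V : AddVal Ω} {K : Type*} [Field K] [Algebra K Ω]
    (hK : V.IsGoodBase K) (L : IntermediateField K Ω) [FiniteDimensional K L] :
    V.IsGoodBase L where
  inv σ := hK.inv (σ.restrictScalars K)
  gen N hN := by
    have : FiniteDimensional K (N.restrictScalars K) := FiniteDimensional.trans K L N
    obtain ⟨y, hy⟩ := hK.gen (N.restrictScalars K) this
    exact ⟨transportInts (fun _ => Iff.rfl) y, hy.transport _⟩
  sep x := by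
    obtain ⟨g, hg⟩ := hK.sep x
    refine ⟨g.map (intsOfBaseChange V L), ?_⟩
    rwa [derivative_map, aeval_map_intsOfBaseChange, aeval_map_intsOfBaseChange]

section Abs

/-- The order-reversing exponential `w ↦ exp (-w)` on extended real numbers. -/
def expNeg (w : WithTop ℝ) : ℝ := w.recTopCoe 0 fun r => Real.exp (-r)

theorem expNeg_top : expNeg ⊤ = 0 := rfl

theorem expNeg_coe (r : ℝ) : expNeg r = Real.exp (-r) := rfl

theorem expNeg_add (a b : WithTop ℝ) : expNeg (a + b) = expNeg a * expNeg b := by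
  induction a with
  | top => simp [expNeg_top]
  | coe a =>
    induction b with
    | top => simp [expNeg_top]
    | coe b => rw [← WithTop.coe_add, expNeg_coe, expNeg_coe, expNeg_coe, ← Real.exp_add, neg_add]

theorem expNeg_strictAnti : StrictAnti expNeg := by
  intro a b h
  induction b with
  | top =>
    induction a with
    | top => exact absurd h (lt_irrefl _)
    | coe a => exact Real.exp_pos _
  | coe b =>
    induction a with
    | top => exact absurd h not_top_lt
    | coe a =>
      rw [expNeg_coe, expNeg_coe, Real.exp_lt_exp]
      exact neg_lt_neg (by exact_mod_cast h)

theorem expNeg_nonneg (a : WithTop ℝ) : 0 ≤ expNeg a :=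
  expNeg_strictAnti.antitone (le_top : a ≤ ⊤)

theorem expNeg_zero : expNeg 0 = 1 := by
  rw [← WithTop.coe_zero, expNeg_coe, neg_zero, Real.exp_zero]

variable (V : AddVal Ω)

/-- The absolute value attached to an additive valuation. -/
def abs : AbsoluteValue Ω ℝ where
  toFun x := expNeg (V.v x)
  map_mul' x y := by rw [V.v_mul, expNeg_add]
  nonneg' x := expNeg_nonneg _
  eq_zero' x := by
    rw [← expNeg_top, expNeg_strictAnti.injective.eq_iff, V.v_eq_top_iff]
  add_le' x y := by
    refine (expNeg_strictAnti.antitone (V.v_min_le_add x y)).trans ?_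
    rcases min_choice (V.v x) (V.v y) with h | h <;> rw [h]
    · exact le_add_of_nonneg_right (expNeg_nonneg _)
    · exact le_add_of_nonneg_left (expNeg_nonneg _)

theorem abs_apply (x : Ω) : V.abs x = expNeg (V.v x) := rfl

theorem abs_lt_one_iff {x : Ω} : V.abs x < 1 ↔ 0 < V.v x := by
  rw [abs_apply, ← expNeg_zero, expNeg_strictAnti.lt_iff_gt]

theorem one_lt_abs_iff {x : Ω} : 1 < V.abs x ↔ V.v x < 0 := by
  rw [abs_apply, ← expNeg_zero, expNeg_strictAnti.lt_iff_gt]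

end Abs

variable {V : AddVal Ω}

theorem v_div_one_add_sub_one_pos {w : Ω} (hw : V.v w < 0) : 0 < V.v (w / (1 + w) - 1) := by
  have h1 : V.v (1 + w) = V.v w := by
    rw [add_comm]
    exact V.v_add_eq_of_lt (by rwa [V.v_one])
  have h0 : 1 + w ≠ 0 := fun h => by
    rw [← h1, h, V.v_zero] at hw
    exact not_top_lt hw
  have h2 : w / (1 + w) - 1 = -(1 + w)⁻¹ := by
    field_simp
    ring
  rw [h2, V.v_neg]
  by_contra! hc
  have h3 := V.v_inv h0
  rw [h1] at h3
  have h4 : V.v w + V.v (1 + w)⁻¹ ≤ V.v w + 0 := by gcongr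
  rw [add_zero, add_comm, h3] at h4
  exact h4.not_gt hw

theorem v_div_one_add_pos {w : Ω} (hw : 0 < V.v w) : 0 < V.v (w / (1 + w)) := by
  have h1 : V.v (1 + w) = 0 := by
    rw [V.v_add_eq_of_lt (by rwa [V.v_one]), V.v_one]
  have h0 : 1 + w ≠ 0 := fun h => by simp [h, V.v_zero] at h1
  have h2 := V.v_inv h0
  rw [h1, add_zero] at h2
  rwa [div_eq_mul_inv, V.v_mul, h2, add_zero]

section Hensel

variable {F : Type*} [Field F] [Algebra F Ω]

/-- Weak approximation among the conjugates of `V` on `N`. -/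
theorem IsNormalizedOn.exists_approx (hnorm : V.IsNormalizedOn F) (N : IntermediateField F Ω)
    [FiniteDimensional F N] : ∃ z : N, V.v (z : Ω) < 0 ∧ ∀ σ : N ≃ₐ[F] N,
      ¬ (∀ x : N, V.v (σ x : Ω) = V.v (x : Ω)) → 0 < V.v (σ z : Ω) := by
  obtain ⟨π, hπ⟩ := hnorm.2
  let A (s : N →ₐ[F] Ω) : AbsoluteValue N ℝ := V.abs.comp (f := (s : N →+* Ω)) s.injective
  have hA (s : N →ₐ[F] Ω) (x : N) : A s x = V.abs (s x) := rfl
  have hAπ (s : N →ₐ[F] Ω) : A s (algebraMap F N π) = Real.exp (-1) := by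
    rw [hA, s.commutes, abs_apply, hπ]
    rfl
  have hlt : Real.exp (-1) < 1 := by simp
  have hequiv : Pairwise fun i j : Set.range A => ¬ (i : AbsoluteValue N ℝ).IsEquiv j := by
    rintro ⟨_, s, rfl⟩ ⟨_, t, rfl⟩ hne h
    refine hne (Subtype.ext ?_)
    obtain ⟨c, hc, h⟩ := AbsoluteValue.isEquiv_iff_exists_rpow_eq.mp h
    have h1 := congrFun h (algebraMap F N π)
    simp only [hAπ] at h1
    rw [← Real.exp_mul, Real.exp_eq_exp] at h1
    have hc1 : c = 1 := by linarith
    ext x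
    have := congrFun h x
    rwa [hc1, Real.rpow_one] at this
  obtain ⟨z, hz1, hz2⟩ := AbsoluteValue.exists_one_lt_lt_one_pi_of_not_isEquiv
    (v := fun i : Set.range A => (i : AbsoluteValue N ℝ)) (by
      rintro ⟨_, s, rfl⟩
      refine ⟨algebraMap F N π, fun h0 => ?_, ?_⟩
      · have := hAπ s
        rw [h0, map_zero] at this
        exact (Real.exp_pos _).ne this
      · rw [hAπ]
        exact hlt.ne) hequiv ⟨A N.val, N.val, rfl⟩
  refine ⟨z, V.one_lt_abs_iff.mp hz1, fun σ hσ => ?_⟩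
  refine V.abs_lt_one_iff.mp (hz2 ⟨A (N.val.comp (σ : N →ₐ[F] N)), _, rfl⟩ fun h => hσ fun x => ?_)
  have h1 := congrArg (fun f : AbsoluteValue N ℝ => f x) (congrArg Subtype.val h)
  exact expNeg_strictAnti.injective h1

/-- Over a Henselian discretely valued field, `V` is invariant under finite Galois groups. -/
theorem IsHenselianOn.v_algEquiv (hhens : V.IsHenselianOn F) (hnorm : V.IsNormalizedOn F)
    (N : IntermediateField F Ω) [FiniteDimensional F N] [IsGalois F N] (τ : N ≃ₐ[F] N) (x : N) :
    V.v (τ x : Ω) = V.v (x : Ω) := by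
  obtain ⟨z, hz, hzD⟩ := hnorm.exists_approx N
  set D : Finset (N ≃ₐ[F] N) :=
    Finset.univ.filter fun σ => ∀ x : N, V.v (σ x : Ω) = V.v (x : Ω) with hD
  have memD (σ : N ≃ₐ[F] N) : σ ∈ D ↔ ∀ x : N, V.v (σ x : Ω) = V.v (x : Ω) := by simp [hD]
  by_cases hτ : τ ∈ D
  · exact (memD τ).mp hτ x
  exfalso
  have one_mem : (1 : N ≃ₐ[F] N) ∈ D := (memD 1).mpr fun x => rfl
  have mul_mem {σ h : N ≃ₐ[F] N} (hh : h ∈ D) : σ * h ∈ D ↔ σ ∈ D := by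
    rw [memD] at hh
    refine ⟨fun H => (memD _).mpr fun x => ?_, fun H => (memD _).mpr fun x => ?_⟩
    · have h1 := (memD _).mp H (h.symm x)
      have h2 := hh (h.symm x)
      rw [AlgEquiv.mul_apply, AlgEquiv.apply_symm_apply] at h1
      rw [AlgEquiv.apply_symm_apply] at h2
      rw [h1, h2]
    · rw [AlgEquiv.mul_apply, (memD _).mp H, hh]
  set y : N := z / (1 + z) with hy
  have hσy (σ : N ≃ₐ[F] N) : ((σ y : N) : Ω) = (σ z : Ω) / (1 + (σ z : Ω)) := by
    rw [hy, map_div₀, map_add, map_one]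
    rfl
  have hyD (σ : N ≃ₐ[F] N) (hσ : σ ∈ D) : 0 < V.v ((σ y : Ω) - 1) := by
    rw [hσy]
    exact v_div_one_add_sub_one_pos (by rwa [(memD σ).mp hσ])
  have hyD' (σ : N ≃ₐ[F] N) (hσ : σ ∉ D) : 0 < V.v (σ y : Ω) := by
    rw [hσy]
    exact v_div_one_add_pos (hzD σ (by rwa [memD] at hσ))
  have hyint (σ : N ≃ₐ[F] N) : σ y ∈ V.intsOf N := by
    rw [mem_intsOf]
    by_cases hσ : σ ∈ D
    · have := V.le_v_add (hyD σ hσ).le V.v_one.ge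
      rwa [sub_add_cancel] at this
    · exact (hyD' σ hσ).le
  set u : (N ≃ₐ[F] N) → V.intsOf N := fun σ => ⟨σ y, hyint σ⟩ with hu
  have hres (σ : N ≃ₐ[F] N) : residue (V.intsOf N) (u σ) = if σ ∈ D then 1 else 0 := by
    split_ifs with hσ
    · rw [← sub_eq_zero, ← map_one (residue _), ← map_sub, residue_intsOf_eq_zero_iff]
      exact hyD σ hσ
    · rw [residue_intsOf_eq_zero_iff]
      exact hyD' σ hσ
  set c : (N ≃ₐ[F] N) → V.intsOf N := fun σ => ∏ h ∈ D, u (σ * h) with hc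
  have hcres (σ : N ≃ₐ[F] N) : residue (V.intsOf N) (c σ) = if σ ∈ D then 1 else 0 := by
    rw [hc, map_prod]
    split_ifs with hσ
    · refine Finset.prod_eq_one fun h hh => ?_
      rw [hres, if_pos ((mul_mem hh).mpr hσ)]
    · refine Finset.prod_eq_zero one_mem ?_
      rw [hres, if_neg (by rwa [mul_mem one_mem])]
  have hcval (σ : N ≃ₐ[F] N) : (c σ : N) = ∏ h ∈ D, σ (h y) := by
    have := map_prod (V.intsOf N).subtype (fun h => u (σ * h)) D
    exact this
  have hσc (σ ρ : N ≃ₐ[F] N) : σ (c ρ : N) = c (σ * ρ) := by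
    rw [hcval, hcval, map_prod]
    rfl
  have hcD (σ : N ≃ₐ[F] N) (hσ : σ ∈ D) : c σ = c 1 := by
    rw [hc]
    refine Finset.prod_bij' (fun h _ => σ * h) (fun h _ => σ⁻¹ * h) ?_ ?_ ?_ ?_ ?_
    · intro h hh
      exact (mul_mem hh).mpr hσ
    · intro h hh
      refine (mul_mem hh).mpr ((mul_mem hσ).mp ?_)
      rwa [inv_mul_cancel]
    · intro h _
      simp
    · intro h _
      simp
    · intro h _
      simp
  set O : Finset (V.intsOf N) := Finset.univ.image c with hO
  have hmemO (σ : N ≃ₐ[F] N) : c σ ∈ O := Finset.mem_image_of_mem _ (Finset.mem_univ _)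
  set P1 : (V.intsOf N)[X] := ∏ r ∈ O, (X - C r) with hP1
  obtain ⟨P0, hP0⟩ : ∃ P0 : F[X], P0.map (algebraMap F N) = P1.map (V.intsOf N).subtype := by
    rw [← mem_lifts, lifts_iff_coeff_lifts]
    intro i
    refine (IsGalois.mem_range_algebraMap_iff_fixed (F := F) _).mpr fun σ => ?_
    have hinv : (P1.map (V.intsOf N).subtype).map (σ : N →+* N) =
        P1.map (V.intsOf N).subtype := by
      rw [hP1, Polynomial.map_prod, Polynomial.map_prod]
      refine Finset.prod_bij' (fun r hr => if hr' : σ r ∈ V.intsOf N then ⟨σ r, hr'⟩ else r)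
        (fun r hr => if hr' : σ⁻¹ r ∈ V.intsOf N then ⟨σ⁻¹ r, hr'⟩ else r) ?_ ?_ ?_ ?_ ?_
      all_goals
        intro r hr
        obtain ⟨ρ, -, rfl⟩ := Finset.mem_image.mp hr
        simp [hσc, hmemO]
    conv_rhs => rw [← hinv, coeff_map]
    rfl
  have hP0coeff (i : ℕ) : algebraMap F N (P0.coeff i) = P1.coeff i := by
    rw [← coeff_map, hP0, coeff_map]
    rfl
  have heval (Q0 : F[X]) (Q1 : (V.intsOf N)[X])
      (hQ : Q0.map (algebraMap F N) = Q1.map (V.intsOf N).subtype) :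
      algebraMap F Ω (Q0.eval 1) = algebraMap N Ω (Q1.eval 1 : V.intsOf N) := by
    rw [IsScalarTower.algebraMap_apply F N Ω]
    congr 1
    rw [← eval₂_at_one, ← eval_map, hQ, eval_map, eval₂_at_one]
    rfl
  have hsplit : P1 = (X - C (c 1)) * ∏ r ∈ O.erase (c 1), (X - C r) :=
    (Finset.mul_prod_erase O _ (hmemO 1)).symm
  have hres1 : residue (V.intsOf N) (1 - c 1) = 0 := by
    rw [map_sub, map_one, hcres, if_pos one_mem, sub_self]
  obtain ⟨a, ha, -⟩ := hhens P0 (fun i => by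
      rw [IsScalarTower.algebraMap_apply F N Ω, hP0coeff]
      exact (P1.coeff i).2) 1 (by rw [map_one, V.v_one]) (by
      rw [heval P0 P1 hP0, ← residue_intsOf_eq_zero_iff, hsplit, eval_mul, map_mul, eval_sub,
        eval_X, eval_C, hres1, zero_mul]) (by
      rw [heval _ (derivative P1) (by rw [← derivative_map, hP0, derivative_map]),
        ← isUnit_intsOf_iff, ← residue_ne_zero_iff_isUnit, hsplit, derivative_mul]
      simp only [derivative_sub, derivative_X, derivative_C, sub_zero, one_mul, eval_add, eval_mul,
        eval_sub, eval_X, eval_C, map_add, map_mul, hres1, zero_mul, add_zero]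
      rw [eval_prod, map_prod, Finset.prod_eq_one]
      · exact one_ne_zero
      · intro r hr
        obtain ⟨hne, hr⟩ := Finset.mem_erase.mp hr
        obtain ⟨σ, -, rfl⟩ := Finset.mem_image.mp hr
        have hσ : σ ∉ D := fun hσ => hne (hcD σ hσ)
        simp [hcres, hσ])
  have ha' : (P1.map (V.intsOf N).subtype).eval (algebraMap F N a) = 0 := by
    rw [← hP0, eval_map, eval₂_at_apply, ha, map_zero]
  rw [hP1, Polynomial.map_prod, eval_prod, Finset.prod_eq_zero_iff] at ha'
  obtain ⟨r, hr, hra⟩ := ha'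
  obtain ⟨σ, -, rfl⟩ := Finset.mem_image.mp hr
  simp only [Polynomial.map_sub, map_X, map_C, eval_sub, eval_X, eval_C, sub_eq_zero] at hra
  have hfix (ρ : N ≃ₐ[F] N) : (c ρ : N) = algebraMap F N a := by
    have h1 : (c ρ : N) = (ρ * σ⁻¹) (c σ) := by rw [hσc, inv_mul_cancel_right]
    rw [h1]
    change (ρ * σ⁻¹) ((V.intsOf N).subtype (c σ)) = _
    rw [← hra, AlgEquiv.commutes]
  have h1 := hcres 1
  have h2 := hcres τ
  rw [if_pos one_mem, Subtype.ext ((hfix 1).trans (hfix τ).symm), h2, if_neg hτ] at h1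
  exact zero_ne_one h1

theorem IsHenselianOn.isInvariantOver [IsGalois F Ω] (hhens : V.IsHenselianOn F)
    (hnorm : V.IsNormalizedOn F) : V.IsInvariantOver F := by
  intro σ x
  have hx : IsIntegral F x := Algebra.IsIntegral.isIntegral x
  have : FiniteDimensional F (IntermediateField.adjoin F {x}) :=
    IntermediateField.adjoin.finiteDimensional hx
  set N := IntermediateField.normalClosure F (IntermediateField.adjoin F {x}) Ω with hN
  have hxN : x ∈ N := IntermediateField.le_normalClosure _
    (IntermediateField.mem_adjoin_simple_self F x)
  have : Normal F N := normalClosure.normal _ _ _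
  have : IsGalois F N := ⟨⟩
  have h := hhens.v_algEquiv hnorm N (σ.restrictNormal N) ⟨x, hxN⟩
  have h2 := σ.restrictNormal_commutes N ⟨x, hxN⟩
  rw [← h]
  exact congrArg V.v h2.symm

end Hensel

end AddVal

namespace AddVal

variable {Ω : Type*} [Field Ω] {V : AddVal Ω} {K : Type*} [Field K] [Algebra K Ω]

/-- Ramification indices exist for finite extensions. -/
theorem IsInvariantOver.exists_isRamIdx [IsGalois K Ω] (hinv : V.IsInvariantOver K) {eK : ℕ}
    (hKe : V.FieldRamIdx K eK) (N : IntermediateField K Ω) [FiniteDimensional K N] :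
    ∃ e, V.IsRamIdx N e := by
  obtain ⟨heK, hKint, hKunif⟩ := hKe
  set n := Fintype.card (N →ₐ[K] Ω) * eK with hn
  have hn0 : 0 < n := Nat.mul_pos (Fintype.card_pos_iff.mpr ⟨N.val⟩) heK
  have hnR : (0 : ℝ) < n := by exact_mod_cast hn0
  have key (x : N) (hx : x ≠ 0) : ∃ k : ℤ, V.v (x : Ω) = (((k : ℝ) / n : ℝ) : WithTop ℝ) := by
    obtain ⟨c, hc⟩ := (InfiniteGalois.mem_range_algebraMap_iff_fixed (k := K)
      (∏ s : N →ₐ[K] Ω, s x)).mpr fun σ => by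
        rw [map_prod]
        exact Fintype.prod_equiv ⟨fun s => (σ : Ω →ₐ[K] Ω).comp s,
          fun s => (σ.symm : Ω →ₐ[K] Ω).comp s, fun s => by ext; simp, fun s => by ext; simp⟩ _ _
          fun s => rfl
    have hv := congrArg V.v hc
    rw [V.v_prod, Finset.sum_congr rfl fun s _ => hinv.v_algHom s x, Finset.sum_const,
      Finset.card_univ] at hv
    have hxΩ : (x : Ω) ≠ 0 := by simpa using hx
    have hc0 : c ≠ 0 := fun h => by
      rw [h, map_zero] at hc
      exact hx ((map_eq_zero _).mp (Finset.prod_eq_zero_iff.mp hc.symm).choose_spec.2)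
    obtain ⟨k, hk⟩ := hKint c hc0
    rw [hk] at hv
    refine ⟨k, ?_⟩
    lift V.v (x : Ω) to ℝ using V.v_ne_top _ hxΩ with w
    have hv' : (k : ℝ) / eK = Fintype.card (N →ₐ[K] Ω) • w := by exact_mod_cast hv
    have heR : (0 : ℝ) < eK := by exact_mod_cast heK
    have hw : w = (k : ℝ) / n := by
      rw [eq_div_iff hnR.ne', hn]
      rw [div_eq_iff heR.ne', nsmul_eq_mul] at hv'
      rw [hv']
      push_cast
      ring
    rw [hw]
  let H : AddSubgroup ℤ :=
    { carrier := {k | ∃ x : N, x ≠ 0 ∧ V.v (x : Ω) = (((k : ℝ) / n : ℝ) : WithTop ℝ)}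
      add_mem' := by
        rintro a b ⟨x, hx, hxa⟩ ⟨y, hy, hyb⟩
        refine ⟨x * y, mul_ne_zero hx hy, ?_⟩
        change V.v ((x : Ω) * y) = _
        rw [V.v_mul, hxa, hyb, Int.cast_add, add_div, WithTop.coe_add]
      zero_mem' := ⟨1, one_ne_zero, by
        change V.v (1 : Ω) = _
        rw [V.v_one]
        simp⟩
      neg_mem' := by
        rintro a ⟨x, hx, hxa⟩
        refine ⟨x⁻¹, inv_ne_zero hx, ?_⟩
        have h := V.v_inv (x := (x : Ω)) (by simpa using hx)
        change V.v ((x : Ω)⁻¹) = _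
        rw [hxa] at h
        lift V.v ((x : Ω)⁻¹) to ℝ using V.v_ne_top _ (inv_ne_zero (by simpa using hx)) with w
        have h' : w + (a : ℝ) / n = 0 := by exact_mod_cast h
        push_cast
        rw [neg_div, eq_neg_of_add_eq_zero_left h'] }
  obtain ⟨g, hg⟩ := Int.subgroup_cyclic H
  have hmem (k : ℤ) : k ∈ H ↔ g ∣ k := by
    rw [hg, ← AddSubgroup.zmultiples_eq_closure, Int.mem_zmultiples_iff]
  obtain ⟨ϖ, hϖ⟩ := hKunif
  have hϖ0 : ϖ ≠ 0 := fun h => by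
    rw [h, map_zero, V.v_zero] at hϖ
    exact WithTop.top_ne_coe hϖ
  have heR : (0 : ℝ) < eK := by exact_mod_cast heK
  have hcard : ((Fintype.card (N →ₐ[K] Ω) : ℕ) : ℤ) ∈ H := by
    refine ⟨algebraMap K N ϖ, by simpa using hϖ0, ?_⟩
    change V.v (algebraMap K Ω ϖ) = _
    have hcR : (0 : ℝ) < Fintype.card (N →ₐ[K] Ω) := by
      exact_mod_cast Fintype.card_pos_iff.mpr ⟨N.val⟩
    rw [hϖ, hn]
    congr 1
    push_cast
    field_simp
  have hnH : (n : ℤ) ∈ H := by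
    rw [hmem] at hcard ⊢
    rw [hn]
    push_cast
    exact hcard.mul_right _
  obtain ⟨m, hm⟩ := (hmem _).mp hnH
  have hg0 : g ≠ 0 := fun h => by
    rw [h, zero_mul] at hm
    omega
  have hm0 : m ≠ 0 := fun h => by
    rw [h, mul_zero] at hm
    omega
  have hgR : (g : ℝ) ≠ 0 := by exact_mod_cast hg0
  have hmR : (m : ℝ) ≠ 0 := by exact_mod_cast hm0
  have hnm : (n : ℝ) = (g : ℝ) * m := by exact_mod_cast hm
  have habs : ∃ u : ℤ, (u = 1 ∨ u = -1) ∧ ((m.natAbs : ℕ) : ℤ) = u * m := by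
    rcases Int.natAbs_eq m with h | h
    · exact ⟨1, Or.inl rfl, by omega⟩
    · exact ⟨-1, Or.inr rfl, by omega⟩
  obtain ⟨u, hu, hum⟩ := habs
  have huu : (u : ℝ) * u = 1 := by rcases hu with rfl | rfl <;> norm_num
  have hu0 : (u : ℝ) ≠ 0 := fun h => by simp [h] at huu
  have humR : ((m.natAbs : ℕ) : ℝ) = (u : ℝ) * m := by
    rw [← Int.cast_natCast, hum, Int.cast_mul]
  refine ⟨m.natAbs, Int.natAbs_pos.mpr hm0, fun x hx => ?_, ?_⟩
  · obtain ⟨k, hk⟩ := key x hx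
    obtain ⟨j, hj⟩ := (hmem k).mp ⟨x, hx, hk⟩
    refine ⟨u * j, ?_⟩
    rw [hk, hj, hnm, humR]
    congr 1
    push_cast
    field_simp
  · obtain ⟨x, hx, hxg⟩ := (hmem (u * g)).mpr (Dvd.intro_left u rfl)
    refine ⟨x, ?_⟩
    rw [hxg, hnm, humR]
    congr 1
    push_cast
    field_simp
    linear_combination huu

theorem IsNormalizedOn.fieldRamIdx (h : V.IsNormalizedOn K) : V.FieldRamIdx K 1 := by
  refine ⟨one_pos, ?_, ?_⟩
  · simpa using h.1
  · simpa using h.2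

theorem IsInvariantOver.isIntegral [IsGalois K Ω] (hinv : V.IsInvariantOver K) (x : V.ints) :
    IsIntegral (V.intsOf K) x := by
  have hx : IsIntegral K (x : Ω) := Algebra.IsIntegral.isIntegral _
  have : FiniteDimensional K (IntermediateField.adjoin K {(x : Ω)}) :=
    IntermediateField.adjoin.finiteDimensional hx
  set N := IntermediateField.adjoin K {(x : Ω)} with hN
  have hxN : (x : Ω) ∈ N := IntermediateField.mem_adjoin_simple_self K _
  set y : V.intsOf N := ⟨⟨x, hxN⟩, x.2⟩ with hy
  set b : (⊥ : IntermediateField K Ω) →ₐ[K] Ω := (⊥ : IntermediateField K Ω).val with hb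
  obtain ⟨Q, hQ⟩ := hinv.exists_map_eq (fiberPoly bot_le hinv y b) fun σ => by
    rw [map_fiberPoly]
    congr 1
    ext z
    obtain ⟨k, hk⟩ := IntermediateField.mem_bot.mp z.2
    simp [hb, ← hk]
  refine ⟨Q, monic_of_injective (f := algebraMap (V.intsOf K) V.ints) (fun a b h => ?_) ?_, ?_⟩
  · exact Subtype.ext ((algebraMap K Ω).injective (congrArg Subtype.val h))
  · rw [hQ]
    exact monic_prod_of_monic _ _ fun s _ => monic_X_sub_C _
  · rw [← eval_map, hQ, fiberPoly, eval_prod]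
    refine Finset.prod_eq_zero (i := N.val) ((mem_fiber _).mpr rfl) ?_
    rw [eval_sub, eval_X, eval_C, sub_eq_zero]
    rfl

theorem HasPerfectResidueFieldOn.perfectField (h : V.HasPerfectResidueFieldOn K) :
    PerfectField (ResidueField (V.intsOf K)) := by
  obtain ⟨p, hp⟩ := CharP.exists (ResidueField (V.intsOf K))
  rcases CharP.char_is_prime_or_zero (ResidueField (V.intsOf K)) p with hpp | rfl
  · have : Fact p.Prime := ⟨hpp⟩
    have : PerfectRing (ResidueField (V.intsOf K)) p := by
      refine PerfectRing.ofSurjective _ _ fun x => ?_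
      obtain ⟨x, rfl⟩ := residue_surjective x
      have hp0 : 0 < V.v (algebraMap K Ω (p : K)) := by
        have := (V.residue_intsOf_eq_zero_iff K (x := (p : V.intsOf K))).mp (by simp)
        simpa using this
      obtain ⟨y, hy, hxy⟩ := h p hpp hp0 x x.2
      refine ⟨residue _ ⟨y, hy⟩, ?_⟩
      rw [frobenius_def, ← map_pow, eq_comm, ← sub_eq_zero, ← map_sub,
        residue_intsOf_eq_zero_iff]
      exact hxy
    exact PerfectRing.toPerfectField _ p
  · have : CharZero (ResidueField (V.intsOf K)) := CharP.charP_to_charZero _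
    infer_instance

theorem IsInvariantOver.isResiduallySeparableOver [IsGalois K Ω] (hinv : V.IsInvariantOver K)
    (hperf : V.HasPerfectResidueFieldOn K) : V.IsResiduallySeparableOver K := by
  intro x
  have := hperf.perfectField
  have hint : IsIntegral (ResidueField (V.intsOf K)) (residue V.ints x) := by
    obtain ⟨Q, hQ, hQx⟩ := hinv.isIntegral x
    refine ⟨Q.map (residue _), hQ.map _, ?_⟩
    rw [← aeval_def, ← residue_aeval, aeval_def, hQx, map_zero]
  have hsep := PerfectField.separable_of_irreducible (minpoly.irreducible hint)
  obtain ⟨g, hg⟩ := map_surjective _ residue_surjective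
    (minpoly (ResidueField (V.intsOf K)) (residue V.ints x))
  refine ⟨g, ?_, ?_⟩
  · rw [residue_aeval, hg, minpoly.aeval]
  · rw [residue_aeval, ← derivative_map, hg]
    exact hsep.aeval_derivative_ne_zero (minpoly.aeval _ _)

end AddVal

namespace AddVal

variable {Ω : Type*} [Field Ω] {V : AddVal Ω} {K : Type*} [Field K] [Algebra K Ω]

theorem FieldRamIdx.isDiscreteValuationRing {e : ℕ} (h : V.FieldRamIdx K e) :
    IsDiscreteValuationRing (V.intsOf K) := by
  obtain ⟨ϖ, hϖ⟩ := h.2.2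
  have heR : (0 : ℝ) < e := by exact_mod_cast h.1
  have hϖpos : 0 < V.v (algebraMap K Ω ϖ) := by
    rw [hϖ]
    exact_mod_cast one_div_pos.mpr heR
  have hϖ0 : ϖ ≠ 0 := fun h => by
    rw [h, map_zero, V.v_zero] at hϖ
    exact WithTop.top_ne_coe hϖ
  refine IsDiscreteValuationRing.ofHasUnitMulPowIrreducibleFactorization
    ⟨⟨ϖ, hϖpos.le⟩, ⟨fun hu => ?_, fun a b hab => ?_⟩, fun {x} hx => ?_⟩
  · rw [isUnit_intsOf_iff] at hu
    exact hϖpos.ne' hu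
  · by_contra! hc
    rw [isUnit_intsOf_iff, isUnit_intsOf_iff] at hc
    have ha := h.le_of_pos (lt_of_le_of_ne a.2 (Ne.symm hc.1))
    have hb := h.le_of_pos (lt_of_le_of_ne b.2 (Ne.symm hc.2))
    have h1 : V.v (algebraMap K Ω ϖ) = V.v (algebraMap K Ω (a : K)) +
        V.v (algebraMap K Ω (b : K)) := by
      rw [← V.v_mul, ← map_mul]
      exact congrArg (fun z : V.intsOf K => V.v (algebraMap K Ω (z : K))) hab
    have h2 := add_le_add ha hb
    rw [← h1, hϖ, ← WithTop.coe_add, WithTop.coe_le_coe] at h2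
    have := one_div_pos.mpr heR
    linarith
  · have hx0 : (x : K) ≠ 0 := fun h => hx (Subtype.ext h)
    obtain ⟨k, hk⟩ := h.2.1 x hx0
    have hxnn : 0 ≤ V.v (algebraMap K Ω (x : K)) := x.2
    have hk0 : 0 ≤ k := by
      rw [hk] at hxnn
      have h1 : (0 : ℝ) ≤ k / e := by exact_mod_cast hxnn
      have h2 := mul_nonneg h1 heR.le
      rw [div_mul_cancel₀ _ heR.ne'] at h2
      exact_mod_cast h2
    lift k to ℕ using hk0
    refine ⟨k, ?_⟩
    have hpow : V.v (algebraMap K Ω (ϖ ^ k)) = V.v (algebraMap K Ω (x : K)) := by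
      rw [map_pow, V.v_pow, hϖ, hk, ← WithTop.coe_nsmul]
      congr 1
      rw [nsmul_eq_mul, Int.cast_natCast]
      ring
    have hu : V.v (algebraMap K Ω ((x : K) * (ϖ ^ k)⁻¹)) = 0 := by
      have := V.v_inv (x := algebraMap K Ω (ϖ ^ k)) (by simpa using fun h => absurd h hϖ0)
      rw [map_mul, V.v_mul, map_inv₀, ← hpow, add_comm]
      exact this
    obtain ⟨u, hu'⟩ := (V.isUnit_intsOf_iff K (x := ⟨(x : K) * (ϖ ^ k)⁻¹, hu.ge⟩)).mpr hu
    refine ⟨u, Subtype.ext ?_⟩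
    have hu2 : ((u : V.intsOf K) : K) = (x : K) * (ϖ ^ k)⁻¹ := congrArg Subtype.val hu'
    change ϖ ^ k * ((u : V.intsOf K) : K) = x
    rw [hu2, mul_comm, inv_mul_cancel_right₀ (pow_ne_zero _ hϖ0)]

section Tower

variable (N : IntermediateField K Ω)

instance : Algebra (V.intsOf K) (V.intsOf N) := (intsOfBaseChange V N).toAlgebra

instance : IsScalarTower (V.intsOf K) (V.intsOf N) V.ints := IsScalarTower.of_algebraMap_eq' rfl

instance : IsScalarTower (V.intsOf K) (V.intsOf N) N := IsScalarTower.of_algebraMap_eq' rfl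

instance : IsScalarTower (V.intsOf K) K N := IsScalarTower.of_algebraMap_eq' rfl

instance : IsLocalHom (algebraMap (V.intsOf K) (V.intsOf N)) :=
  ⟨fun _ hx => (V.isUnit_intsOf_iff K).mpr ((V.isUnit_intsOf_iff N).mp hx)⟩

theorem algebraMap_intsOf_ints_injective :
    Function.Injective (algebraMap (V.intsOf K) V.ints) := fun _ _ h =>
  Subtype.ext ((algebraMap K Ω).injective (congrArg Subtype.val h))

theorem IsInvariantOver.isIntegralClosure [IsGalois K Ω] (hinv : V.IsInvariantOver K) :
    IsIntegralClosure (V.intsOf N) (V.intsOf K) N where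
  algebraMap_injective := Subtype.val_injective
  isIntegral_iff {x} := by
    constructor
    · intro h
      exact IsIntegrallyClosed.isIntegral_iff.mp (h.tower_top (A := V.intsOf N))
    · rintro ⟨y, rfl⟩
      refine IsIntegral.algebraMap ?_
      have h := hinv.isIntegral (algebraMap (V.intsOf N) V.ints y)
      exact (isIntegral_algebraMap_iff algebraMap_intsOf_ints_injective).mp h

theorem IsInvariantOver.finite_intsOf [IsGalois K Ω] (hinv : V.IsInvariantOver K) {eK : ℕ}
    (hKe : V.FieldRamIdx K eK) [FiniteDimensional K N] :
    Module.Finite (V.intsOf K) (V.intsOf N) := by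
  have := hinv.isIntegralClosure N
  have := hKe.isDiscreteValuationRing
  exact IsIntegralClosure.finite (V.intsOf K) K N (V.intsOf N)

end Tower

theorem exists_residue_generator (N : IntermediateField K Ω)
    [Module.Finite (V.intsOf K) (V.intsOf N)] [PerfectField (ResidueField (V.intsOf K))] :
    ∃ (a : V.intsOf N) (f : (V.intsOf K)[X]),
      (∀ z : V.intsOf N, ∃ g : (V.intsOf K)[X], residue _ (aeval a g) = residue _ z) ∧
      residue _ (aeval a f) = 0 ∧ residue _ (aeval a (derivative f)) ≠ 0 := by
  have hres (g : (V.intsOf K)[X]) (a : V.intsOf N) : residue (V.intsOf N) (aeval a g) =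
      aeval (residue _ a) (g.map (residue (V.intsOf K))) := by
    rw [aeval_def, hom_eval₂, aeval_def, eval₂_map]
    rfl
  obtain ⟨θ, hθ⟩ := Field.exists_primitive_element (ResidueField (V.intsOf K))
    (ResidueField (V.intsOf N))
  have hθint : IsIntegral (ResidueField (V.intsOf K)) θ := Algebra.IsIntegral.isIntegral θ
  obtain ⟨a, rfl⟩ := residue_surjective θ
  obtain ⟨f, hf⟩ := map_surjective _ residue_surjective
    (minpoly (ResidueField (V.intsOf K)) (residue (V.intsOf N) a))
  refine ⟨a, f, fun z => ?_, ?_, ?_⟩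
  · have hz : residue _ z ∈ Algebra.adjoin (ResidueField (V.intsOf K))
        {residue (V.intsOf N) a} := by
      rw [← IntermediateField.adjoin_simple_toSubalgebra_of_isAlgebraic hθint.isAlgebraic, hθ]
      trivial
    rw [Algebra.adjoin_singleton_eq_range_aeval] at hz
    obtain ⟨g, hg⟩ := hz
    obtain ⟨g, rfl⟩ := map_surjective _ residue_surjective g
    exact ⟨g, by rw [hres]; exact hg⟩
  · rw [hres, hf, minpoly.aeval]
  · rw [hres, ← derivative_map, hf]
    exact (PerfectField.separable_of_irreducible
      (minpoly.irreducible hθint)).aeval_derivative_ne_zero (minpoly.aeval _ _)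

theorem dvd_intsOf_of_v_le {x y : V.intsOf K} (hx : x ≠ 0)
    (h : V.v (algebraMap K Ω x) ≤ V.v (algebraMap K Ω y)) : x ∣ y := by
  have hx0 : (x : K) ≠ 0 := fun h => hx (Subtype.ext h)
  refine ⟨⟨(x : K)⁻¹ * y, ?_⟩, Subtype.ext ?_⟩
  · rw [mem_intsOf, map_mul, V.v_mul, map_inv₀,
      ← V.v_inv (x := algebraMap K Ω x) (by simpa using hx0)]
    gcongr
  · exact (mul_inv_cancel_left₀ hx0 _).symm

theorem exists_generator_and_uniformizer (N : IntermediateField K Ω)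
    [Module.Finite (V.intsOf K) (V.intsOf N)] [PerfectField (ResidueField (V.intsOf K))] {e : ℕ}
    (he : V.IsRamIdx N e) :
    ∃ (a : V.intsOf N) (f : (V.intsOf K)[X]),
      (∀ z : V.intsOf N, ∃ g : (V.intsOf K)[X], residue _ (aeval a g) = residue _ z) ∧
      V.v (algebraMap N Ω (aeval a f : V.intsOf N)) = ((1 / e : ℝ) : WithTop ℝ) := by
  have hef := isRamIdx_iff.mp he
  have heR : (0 : ℝ) < e := by exact_mod_cast he.1
  obtain ⟨a, f, hgen, hf, hf'⟩ := exists_residue_generator (V := V) N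
  rw [residue_intsOf_eq_zero_iff] at hf
  by_cases hfa : V.v (algebraMap N Ω (aeval a f : V.intsOf N)) = ((1 / e : ℝ) : WithTop ℝ)
  · exact ⟨a, f, hgen, hfa⟩
  have hlt := lt_of_le_of_ne (hef.le_of_pos hf) (Ne.symm hfa)
  obtain ⟨ϖ, hϖ⟩ := he.2.2
  have hpos : (0 : WithTop ℝ) < ((1 / e : ℝ) : WithTop ℝ) := by
    exact_mod_cast one_div_pos.mpr heR
  set w : V.intsOf N := ⟨ϖ, by rw [mem_intsOf]; exact hϖ ▸ hpos.le⟩ with hw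
  have hwv : V.v (algebraMap N Ω (w : N)) = ((1 / e : ℝ) : WithTop ℝ) := hϖ
  have hw0 : residue _ w = 0 := by
    rw [residue_intsOf_eq_zero_iff, hwv]
    exact hpos
  refine ⟨a + w, f, fun z => ?_, ?_⟩
  · obtain ⟨g, hg⟩ := hgen z
    refine ⟨g, ?_⟩
    rw [← hg, ← sub_eq_zero, ← map_sub, residue_eq_zero_iff]
    have h1 : a + w - a ∣ aeval (a + w) g - aeval a g := by
      rw [aeval_def, aeval_def, eval₂_eq_eval_map, eval₂_eq_eval_map]
      exact sub_dvd_eval_sub _ _ _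
    rw [add_sub_cancel_left] at h1
    exact Ideal.mem_of_dvd _ h1 ((residue_eq_zero_iff _).mp hw0)
  · obtain ⟨k, hk⟩ := binomExpansion (f.map (algebraMap (V.intsOf K) (V.intsOf N))) a w
    rw [derivative_map, eval_map_algebraMap, eval_map_algebraMap, eval_map_algebraMap] at hk
    have hk' : ((aeval (a + w) f : V.intsOf N) : N) = (aeval a (derivative f) : V.intsOf N) * w +
        ((aeval a f : V.intsOf N) + k * w ^ 2) := by
      rw [hk]
      push_cast
      ring
    have hunit := (residue_ne_zero_iff_isUnit _).mp hf'
    rw [isUnit_intsOf_iff] at hunit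
    have h1 : V.v (algebraMap N Ω ((aeval a (derivative f) : V.intsOf N) * w : N)) =
        ((1 / e : ℝ) : WithTop ℝ) := by
      rw [map_mul, V.v_mul, hunit, zero_add, hwv]
    have h2 : ((1 / e : ℝ) : WithTop ℝ) < V.v (algebraMap N Ω ((k : N) * w ^ 2)) := by
      have h3 : V.v (algebraMap N Ω ((w : N) ^ 2)) = ((2 * (1 / e) : ℝ) : WithTop ℝ) := by
        rw [map_pow, V.v_pow, hwv, ← WithTop.coe_nsmul]
        norm_num
      rw [map_mul]
      refine lt_of_lt_of_le ?_ (V.le_v_mul_of_right k.2 h3.ge)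
      have := one_div_pos.mpr heR
      exact_mod_cast (by linarith : 1 / (e : ℝ) < 2 * (1 / e))
    rw [hk', map_add, V.v_add_eq_of_lt, h1]
    rw [h1, map_add]
    exact lt_of_lt_of_le (lt_min hlt h2) (V.v_min_le_add _ _)

theorem exists_integralGenerator (N : IntermediateField K Ω)
    [Module.Finite (V.intsOf K) (V.intsOf N)] [PerfectField (ResidueField (V.intsOf K))] {eK e : ℕ}
    (hKe : V.FieldRamIdx K eK) (he : V.IsRamIdx N e) :
    ∃ y : V.intsOf N, V.IsIntegralGenerator y := by
  obtain ⟨a, f, hgen, hf⟩ := exists_generator_and_uniformizer N he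
  have heR : (0 : ℝ) < e := by exact_mod_cast he.1
  have heKR : (0 : ℝ) < eK := by exact_mod_cast hKe.1
  set p : V.intsOf N := aeval a f with hp
  have hp0 : p ≠ 0 := fun h => by
    rw [h] at hf
    change V.v (algebraMap N Ω 0) = _ at hf
    rw [map_zero, V.v_zero] at hf
    exact WithTop.top_ne_coe hf
  set A : Subalgebra (V.intsOf K) (V.intsOf N) := (aeval a).range with hA
  have hpA : p ∈ A := ⟨f, rfl⟩
  have hstep (n : ℕ) : ∀ z : V.intsOf N, ∃ b ∈ A, p ^ n ∣ z - b := by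
    induction n with
    | zero => exact fun z => ⟨0, A.zero_mem, by simp⟩
    | succ n ih =>
      intro z
      obtain ⟨b, hb, c, hc⟩ := ih z
      obtain ⟨g, hg⟩ := hgen c
      rw [eq_comm, ← sub_eq_zero, ← map_sub, residue_intsOf_eq_zero_iff] at hg
      obtain ⟨d, hd⟩ := dvd_intsOf_of_v_le hp0
        (hf.trans_le ((isRamIdx_iff.mp he).le_of_pos hg))
      refine ⟨b + p ^ n * aeval a g, A.add_mem hb (A.mul_mem (A.pow_mem hpA n) ⟨g, rfl⟩), d, ?_⟩
      linear_combination hc + p ^ n * hd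
  obtain ⟨ϖ, hϖ⟩ := hKe.2.2
  have hϖpos : 0 < V.v (algebraMap K Ω ϖ) := by
    rw [hϖ]
    exact_mod_cast one_div_pos.mpr heKR
  set π : V.intsOf K := ⟨ϖ, hϖpos.le⟩ with hπ
  have hπ0 : algebraMap (V.intsOf K) (V.intsOf N) π ≠ 0 := fun h => by
    have := congrArg (fun z : V.intsOf N => V.v (algebraMap N Ω (z : N))) h
    change V.v (algebraMap K Ω ϖ) = V.v (algebraMap N Ω 0) at this
    rw [hϖ, map_zero, V.v_zero] at this
    exact WithTop.coe_ne_top this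
  have hdvd : algebraMap (V.intsOf K) (V.intsOf N) π ∣ p ^ e := by
    refine dvd_intsOf_of_v_le hπ0 ?_
    change V.v (algebraMap K Ω ϖ) ≤ V.v (algebraMap N Ω ((p : N) ^ e))
    rw [hϖ, map_pow, V.v_pow, hf, ← WithTop.coe_nsmul, WithTop.coe_le_coe, nsmul_eq_mul,
      mul_one_div_cancel heR.ne', div_le_one heKR]
    exact_mod_cast hKe.1
  have htop : (⊤ : Submodule (V.intsOf K) (V.intsOf N)) ≤ Subalgebra.toSubmodule A := by
    refine Submodule.le_of_le_smul_of_le_jacobson_bot (I := maximalIdeal (V.intsOf K))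
      Module.Finite.fg_top (maximalIdeal_le_jacobson _) fun z _ => ?_
    obtain ⟨b, hb, hz⟩ := hstep e z
    obtain ⟨c, hc⟩ := hdvd.trans hz
    rw [← sub_add_cancel z b, add_comm, hc, ← Algebra.smul_def]
    refine Submodule.add_mem_sup hb (Submodule.smul_mem_smul ?_ trivial)
    rw [← residue_eq_zero_iff, residue_intsOf_eq_zero_iff]
    exact hϖpos
  refine ⟨a, fun z => ?_⟩
  obtain ⟨g, hg⟩ := htop (x := z) trivial
  refine ⟨g, ?_⟩
  rw [← hg]
  exact aeval_algebraMap_apply _ _ _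

/-- The structural facts needed hold over Henselian discretely valued fields with perfect residue
field. -/
theorem IsHenselianOn.isGoodBase [IsGalois K Ω] (hhens : V.IsHenselianOn K)
    (hnorm : V.IsNormalizedOn K) (hperf : V.HasPerfectResidueFieldOn K) : V.IsGoodBase K := by
  have hinv := hhens.isInvariantOver hnorm
  refine ⟨hinv, fun N _ => ?_, hinv.isResiduallySeparableOver hperf⟩
  have := hinv.finite_intsOf N hnorm.fieldRamIdx
  have := hperf.perfectField
  obtain ⟨e, he⟩ := hinv.exists_isRamIdx hnorm.fieldRamIdx N
  exact exists_integralGenerator N hnorm.fieldRamIdx he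

end AddVal

namespace AddVal

variable {Ω : Type*} [Field Ω] {V : AddVal Ω} {K : Type*} [Field K] [Algebra K Ω]

section Transport

variable {L N : IntermediateField K Ω} {N' : IntermediateField L Ω} (hN : ∀ x, x ∈ N' ↔ x ∈ N)

theorem xiRel_transport_iff {e : ℕ} {s : ℝ} {δ : N' →ₐ[L] Ω} {σ : N →ₐ[K] Ω}
    (h : ∀ x : N', δ x = σ ⟨x, (hN x).mp x.2⟩) :
    xiRel V N' e s δ N'.val ↔ xiRel V N e s σ N.val := by
  refine ⟨fun H x hx => ?_, fun H x hx => ?_⟩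
  · have := H ⟨x, (hN x).mpr x.2⟩ hx
    rwa [h] at this
  · rw [h]
    exact H ⟨x, (hN x).mp x.2⟩ hx

end Transport

variable [IsGalois K Ω]

theorem IsGoodBase.herbrand_eq_iff (hK : V.IsGoodBase K) {L N : IntermediateField K Ω}
    (hLN : L ≤ N) [FiniteDimensional K N] {N' : IntermediateField L Ω}
    (hN : ∀ x, x ∈ N' ↔ x ∈ N) {eK eL eN : ℕ} (hKe : V.FieldRamIdx K eK) (hLe : V.IsRamIdx L eL)
    (hNe : V.IsRamIdx N eN) {sL sN l : ℝ} (hsL : 0 ≤ sL) (hsN : 0 ≤ sN)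
    (hl : herbrand V L eL sL = l) : herbrand V N eN sN = l ↔ herbrand V N' eN sN = sL := by
  have : FiniteDimensional K L := .of_injective (IntermediateField.inclusion hLN).toLinearMap
    (IntermediateField.inclusion hLN).injective
  have hL := hK.intermediateField L
  have : FiniteDimensional L N' := finiteDimensional_transport hN
  rw [hK.herbrand_tower hLN hL hN hKe hLe hNe hsN]
  refine ⟨fun h => ?_, fun h => by rw [h, hl]⟩
  exact hK.herbrand_injOn hKe hLe
    (hL.herbrand_nonneg (isRamIdx_iff.mp hLe) (hNe.transport hN) hsN) hsL (h.trans hl.symm)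

/-- Compatibility of the upper numbering with restriction of embeddings. -/
theorem IsGoodBase.xiRel_restr_of_herbrand_eq (hK : V.IsGoodBase K) {L N : IntermediateField K Ω}
    (hLN : L ≤ N) [FiniteDimensional K N] {eK eL eN : ℕ} (hKe : V.FieldRamIdx K eK)
    (hLe : V.IsRamIdx L eL) (hNe : V.IsRamIdx N eN) {sL sN l : ℝ} (hsL : 0 ≤ sL) (hsN : 0 ≤ sN)
    (hl : herbrand V L eL sL = l) (hl' : herbrand V N eN sN = l) {s : N →ₐ[K] Ω}
    (hs : xiRel V N eN sN s N.val) : xiRel V L eL sL (restr hLN s) L.val := by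
  have : FiniteDimensional K L := .of_injective (IntermediateField.inclusion hLN).toLinearMap
    (IntermediateField.inclusion hLN).injective
  have hN (x : Ω) : x ∈ IntermediateField.extendScalars hLN ↔ x ∈ N := Iff.rfl
  have h := hK.xiRel_restr hLN (hK.intermediateField L) hN hLe hNe hsN hs
  rwa [(hK.herbrand_eq_iff hLN hN hKe hLe hNe hsL hsN hl).mp hl'] at h

theorem IsGoodBase.eq_val_of_atMostRamified (hK : V.IsGoodBase K) {L N : IntermediateField K Ω}
    (hLN : L ≤ N) [FiniteDimensional K N] {eK eL eN : ℕ} (hKe : V.FieldRamIdx K eK)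
    (hLe : V.IsRamIdx L eL) (hNe : V.IsRamIdx N eN) {sL sN l : ℝ} (hsL : 0 ≤ sL) (hsN : 0 ≤ sN)
    (hl : herbrand V L eL sL = l) (hl' : herbrand V N eN sN = l) (hram : atMostRamified V L l)
    {s : N →ₐ[K] Ω} (hs : xiRel V N eN sN s N.val) : restr hLN s = L.val :=
  hram L le_rfl (.of_injective (IntermediateField.inclusion hLN).toLinearMap
    (IntermediateField.inclusion hLN).injective) eL sL hLe hsL hl _ _
    (hK.xiRel_restr_of_herbrand_eq hLN hKe hLe hNe hsL hsN hl hl' hs)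

theorem isGalois_normalClosure (N : IntermediateField K Ω) :
    IsGalois K (IntermediateField.normalClosure K N Ω) where
  to_normal := normalClosure.normal _ _ _

/-- An automorphism over `K` which is the identity on `L`, as an automorphism over `L`. -/
def algEquivOfFixing {L : IntermediateField K Ω} (γ : Ω ≃ₐ[K] Ω) (h : ∀ x ∈ L, γ x = x) :
    Ω ≃ₐ[L] Ω :=
  { γ.toRingEquiv with commutes' := fun x => h x x.2 }

theorem IsGoodBase.inUpperRam_of_finite (hK : V.IsGoodBase K) {L : IntermediateField K Ω}
    [FiniteDimensional K L] {eK eL : ℕ} (hKe : V.FieldRamIdx K eK) (hLe : V.IsRamIdx L eL)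
    {sL l : ℝ} (hl0 : 0 ≤ l) (hsL : 0 ≤ sL) (hl : herbrand V L eL sL = l) {γ : Ω ≃ₐ[K] Ω}
    (hγ : inUpperRam V l γ) {δ : Ω ≃ₐ[L] Ω} (hδ : (δ : Ω → Ω) = γ) : inUpperRam V sL δ := by
  intro N eN sN hfin _ hNe hsN hNl
  have hL := hK.intermediateField L
  have : FiniteDimensional K (N.restrictScalars K) := FiniteDimensional.trans K L N
  set M := IntermediateField.normalClosure K (N.restrictScalars K) Ω with hM
  have hNM : N.restrictScalars K ≤ M := IntermediateField.le_normalClosure _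
  have : FiniteDimensional K M := normalClosure.is_finiteDimensional _ _ _
  have hLM : L ≤ M := fun x hx => hNM (N.algebraMap_mem ⟨x, hx⟩)
  obtain ⟨eM, hMe⟩ := hK.inv.exists_isRamIdx hKe M
  obtain ⟨sM, hsM, hMl⟩ := hK.exists_herbrand_eq hKe hMe hl0
  have hγM := hγ M eM sM inferInstance (isGalois_normalClosure _) hMe hsM hMl
  set M' := IntermediateField.extendScalars hLM with hM'
  have hmem (x : Ω) : x ∈ M' ↔ x ∈ M := Iff.rfl
  have : FiniteDimensional L M' := finiteDimensional_transport hmem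
  have hδM : xiRel V M' eM sM (δ.toAlgHom.comp M'.val) M'.val :=
    (xiRel_transport_iff hmem fun x => congrFun hδ x).mpr hγM
  have hMl' := (hK.herbrand_eq_iff hLM hmem hKe hLe hMe hsL hsM hl).mp hMl
  have hNM' : N ≤ M' := fun x hx => hNM hx
  exact hL.xiRel_restr_of_herbrand_eq hNM' (isRamIdx_iff.mp hLe) hNe (hMe.transport hmem) hsN hsM
    hNl hMl' hδM

theorem IsGoodBase.fixes_of_inUpperRam (hK : V.IsGoodBase K) {L : IntermediateField K Ω}
    [FiniteDimensional K L] {eK eL : ℕ} (hKe : V.FieldRamIdx K eK) (hLe : V.IsRamIdx L eL)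
    {sL l : ℝ} (hl0 : 0 ≤ l) (hsL : 0 ≤ sL) (hl : herbrand V L eL sL = l)
    (hram : atMostRamified V L l) {γ : Ω ≃ₐ[K] Ω} (hγ : inUpperRam V l γ) {x : Ω} (hx : x ∈ L) :
    γ x = x := by
  set M := IntermediateField.normalClosure K L Ω with hM
  have hLM : L ≤ M := IntermediateField.le_normalClosure _
  have : FiniteDimensional K M := normalClosure.is_finiteDimensional _ _ _
  obtain ⟨eM, hMe⟩ := hK.inv.exists_isRamIdx hKe M
  obtain ⟨sM, hsM, hMl⟩ := hK.exists_herbrand_eq hKe hMe hl0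
  have h := hK.eq_val_of_atMostRamified hLM hKe hLe hMe hsL hsM hl hMl hram
    (hγ M eM sM inferInstance (isGalois_normalClosure _) hMe hsM hMl)
  exact congrArg (fun f : L →ₐ[K] Ω => f ⟨x, hx⟩) h

theorem IsGoodBase.inUpperRam_of_fixes (hK : V.IsGoodBase K) {L : IntermediateField K Ω}
    [FiniteDimensional K L] {eK eL : ℕ} (hKe : V.FieldRamIdx K eK) (hLe : V.IsRamIdx L eL)
    {sL l : ℝ} (hsL : 0 ≤ sL) (hl : herbrand V L eL sL = l) {γ : Ω ≃ₐ[K] Ω}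
    {δ : Ω ≃ₐ[L] Ω} (hδ : (δ : Ω → Ω) = γ) (h : inUpperRam V sL δ) : inUpperRam V l γ := by
  intro N eN sN _ _ hNe hsN hNl
  have hL := hK.intermediateField L
  set M := IntermediateField.normalClosure K (L ⊔ N : IntermediateField K Ω) Ω with hM
  have hLNM : L ⊔ N ≤ M := IntermediateField.le_normalClosure _
  have hLM : L ≤ M := le_sup_left.trans hLNM
  have hNM : N ≤ M := le_sup_right.trans hLNM
  have : FiniteDimensional K (L ⊔ N : IntermediateField K Ω) :=
    IntermediateField.finiteDimensional_sup L N
  have : FiniteDimensional K M := normalClosure.is_finiteDimensional _ _ _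
  set M' := IntermediateField.extendScalars hLM with hM'
  have hmem (x : Ω) : x ∈ M' ↔ x ∈ M := Iff.rfl
  have : FiniteDimensional L M' := finiteDimensional_transport hmem
  have hgal : IsGalois K M' := isGalois_normalClosure (L ⊔ N)
  have : IsGalois L M' := IsGalois.tower_top_of_isGalois K L M'
  obtain ⟨eM, hMe⟩ := hK.inv.exists_isRamIdx hKe M
  have hMe' : V.IsRamIdx M' eM := hMe.transport hmem
  obtain ⟨sM, hsM, hMl'⟩ := hL.exists_herbrand_eq (isRamIdx_iff.mp hLe) hMe' hsL
  have hMl := (hK.herbrand_eq_iff hLM hmem hKe hLe hMe hsL hsM hl).mpr hMl'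
  have hδM := h M' eM sM inferInstance inferInstance hMe' hsM hMl'
  have hγM : xiRel V M eM sM (γ.toAlgHom.comp M.val) M.val :=
    (xiRel_transport_iff hmem fun x => congrFun hδ x).mp hδM
  exact hK.xiRel_restr_of_herbrand_eq hNM hKe hNe hMe hsN hsM hNl hMl hγM

end AddVal

end RamificationTheory

/-- Let `E/F` be finite, at most `l`-ramified, inside `F^sep`, and
`M/F` a finite Galois extension inside `F^sep` containing `E`.  Then
`Gal(M/F)^l ⊆ Gal(M/E)` and `Gal(M/F)^l = Gal(M/E)^{ψ_{E/F}(l)}`.  Consequently, for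
the upper ramification subgroups of the absolute Galois groups one has
`I_F^l = I_E^{ψ_{E/F}(l)}` inside `Γ_E ⊆ Γ_F`.
Here `sE = ψ_{E/F}(l)`, `sMF = ψ_{M/F}(l)`, `sME = ψ_{M/E}(sE)`, and `M'` denotes `M`
regarded as an extension of `E` (same underlying subfield of `Ω = F^sep`). -/
theorem upper_ramification_base_change
    {F Ω : Type*} [Field F] [Field Ω] [Algebra F Ω] [IsSepClosure F Ω]
    (V : AddVal Ω) (hnorm : V.IsNormalizedOn F) (hhens : V.IsHenselianOn F)
    (hperf : V.HasPerfectResidueFieldOn F)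
    (E M : IntermediateField F Ω) (hEM : E ≤ M)
    (hEfin : FiniteDimensional F ↥E) (hMfin : FiniteDimensional F ↥M)
    (hGal : IsGalois F ↥M)
    (e eM : ℕ) (he : V.IsRamIdx E e) (heM : V.IsRamIdx M eM)
    (l : ℕ) (hl : 0 < l) (hram : atMostRamified V E (l : ℝ))
    (M' : IntermediateField ↥E Ω) (hM' : ∀ x : Ω, x ∈ M' ↔ x ∈ M)
    (sE sMF sME : ℝ) (hsE0 : 0 ≤ sE) (hsMF0 : 0 ≤ sMF) (hsME0 : 0 ≤ sME)
    (hsE : herbrand V E e sE = (l : ℝ))    -- `sE = ψ_{E/F}(l)`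
    (hsMF : herbrand V M eM sMF = (l : ℝ)) -- `sMF = ψ_{M/F}(l)`
    (hsME : herbrand V M' eM sME = sE)     -- `sME = ψ_{M/E}(ψ_{E/F}(l))`
    :
    -- (a) `Gal(M/F)^l ⊆ Gal(M/E)`
    (∀ γ : ↥M ≃ₐ[F] ↥M,
      xiRel V M eM sMF (M.val.comp γ.toAlgHom) M.val →
      ∀ x : ↥M, (x : Ω) ∈ E → γ x = x) ∧
    -- (b) `Gal(M/F)^l = Gal(M/E)^{ψ_{E/F}(l)}`
    (∀ γ : ↥M ≃ₐ[F] ↥M,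
      xiRel V M eM sMF (M.val.comp γ.toAlgHom) M.val ↔
        ((∀ x : ↥M, (x : Ω) ∈ E → γ x = x) ∧
          ∀ δ : ↥M' →ₐ[↥E] Ω,
            (∀ x : ↥M', δ x = ((γ ⟨(x : Ω), (hM' x).mp x.2⟩ : ↥M) : Ω)) →
            xiRel V M' eM sME δ M'.val)) ∧
    -- (c) `I_F^l = I_E^{ψ_{E/F}(l)}` inside `Γ_E ⊆ Γ_F`
    (∀ γ : Ω ≃ₐ[F] Ω,
      inUpperRam V (l : ℝ) γ ↔
        ((∀ x : Ω, x ∈ E → γ x = x) ∧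
          ∀ δ : Ω ≃ₐ[↥E] Ω, (δ : Ω → Ω) = (γ : Ω → Ω) → inUpperRam V sE δ)) := by
  have : IsGalois F Ω := IsSepClosure.isGalois
  have hF : V.IsGoodBase F := hhens.isGoodBase hnorm hperf
  have hE := hF.intermediateField E
  have hFe := hnorm.fieldRamIdx
  have hfin' : FiniteDimensional E M' := AddVal.finiteDimensional_transport hM'
  have hl0 : (0 : ℝ) ≤ l := Nat.cast_nonneg l
  have hfix (γ : M ≃ₐ[F] M) (hγ : xiRel V M eM sMF (M.val.comp γ.toAlgHom) M.val) (x : M)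
      (hx : (x : Ω) ∈ E) : γ x = x :=
    Subtype.ext (congrArg (fun f : E →ₐ[F] Ω => f ⟨x, hx⟩)
      (hF.eq_val_of_atMostRamified hEM hFe he heM hsE0 hsMF0 hsE hsMF hram hγ))
  have hs : sME = sMF := hE.herbrand_injOn (AddVal.isRamIdx_iff.mp he) (heM.transport hM') hsME0
    hsMF0 (hsME.trans ((hF.herbrand_eq_iff hEM hM' hFe he heM hsE0 hsMF0 hsE).mp hsMF).symm)
  subst hs
  refine ⟨hfix, fun γ => ⟨fun hγ => ⟨hfix γ hγ, fun δ hδ => ?_⟩, fun ⟨h, hδ⟩ => ?_⟩,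
    fun γ => ⟨fun hγ => ⟨fun x hx => ?_, fun δ hδ => ?_⟩, fun ⟨h, hδ⟩ => ?_⟩⟩
  · exact (AddVal.xiRel_transport_iff hM' hδ).mpr hγ
  · have hres : AddVal.restr hEM (M.val.comp γ.toAlgHom) = E.val := by
      ext x
      exact congrArg Subtype.val (h ⟨x, hEM x.2⟩ x.2)
    exact (AddVal.xiRel_transport_iff hM' fun x => rfl).mp
      (hδ (AddVal.upperHom hM' hEM _ hres) fun x => rfl)
  · exact hF.fixes_of_inUpperRam hFe he hl0 hsE0 hsE hram hγ hx
  · exact hF.inUpperRam_of_finite hFe he hl0 hsE0 hsE hγ hδ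
  · exact hF.inUpperRam_of_fixes hFe he hsE0 hsE (γ := γ) rfl
      (hδ (AddVal.algEquivOfFixing γ h) rfl)
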